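/- arXiv:1603.03910 — 4 statements merged into one kernel-verified Lean document; each statement's English description precedes it below -/
import Mathlib

section
/- With C_n as defined, for every m ≥ 0 the polynomial C_{4m} is a Z/2-linear combination of the polynomials C_k with k < 4m. -/
open Polynomial

/-- The polynomial `t (t+1)^3`. -/
noncomputable def uP : Polynomial (ZMod 2) := X * (X + 1) ^ 3

/-- The polynomial `t^2 + t`. -/
noncomputable def vP : Polynomial (ZMod 2) := X * (X + 1)

/-- The substitution `t ↦ t + 1`. -/
noncomputable def sig : Polynomial (ZMod 2) →ₐ[ZMod 2] Polynomial (ZMod 2) := aeval (X + 1)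

/-- The span of the `u^j t^r` with `r = 0, 1, 3`. -/
noncomputable def MP : Submodule (ZMod 2) (Polynomial (ZMod 2)) :=
  Submodule.span (ZMod 2) {f | ∃ j r : ℕ, (r = 0 ∨ r = 1 ∨ r = 3) ∧ f = uP ^ j * X ^ r}

lemma two_eq_zero' : (2 : Polynomial (ZMod 2)) = 0 := CharTwo.two_eq_zero

lemma sig_X : sig X = X + 1 := by simp [sig]

lemma sig_v : sig vP = vP := by
  simp only [vP, map_mul, map_add, map_one, sig_X]
  linear_combination (X + 1) * two_eq_zero'

lemma sig_u : sig uP = X ^ 4 + X ^ 3 := by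
  simp only [uP, map_mul, map_pow, map_add, map_one, sig_X]
  linear_combination (X + 1) * (3 * X ^ 2 + 6 * X + 4) * two_eq_zero'

lemma X1_monic : (X + 1 : Polynomial (ZMod 2)).Monic := by
  simpa using monic_X_add_C (1 : ZMod 2)

lemma X1_deg : (X + 1 : Polynomial (ZMod 2)).natDegree = 1 := by
  simpa using natDegree_X_add_C (1 : ZMod 2)

lemma u_monic : uP.Monic := monic_X.mul (X1_monic.pow 3)

lemma v_monic : vP.Monic := monic_X.mul X1_monic

lemma u_deg : uP.natDegree = 4 := by
  rw [uP, monic_X.natDegree_mul (X1_monic.pow 3), X1_monic.natDegree_pow, X1_deg, natDegree_X]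

lemma v_deg : vP.natDegree = 2 := by
  rw [vP, monic_X.natDegree_mul X1_monic, X1_deg, natDegree_X]

lemma sub_lead (f p : Polynomial (ZMod 2)) (d : ℕ) (hf : f.degree < (d + 1 : ℕ))
    (hp : p.Monic) (hd : p.natDegree = d) : (f - f.coeff d • p).degree < d := by
  rw [degree_lt_iff_coeff_zero] at hf ⊢
  intro k hk
  rcases Nat.lt_or_ge d k with h | h
  · rw [coeff_sub, coeff_smul, hf k h, coeff_eq_zero_of_natDegree_lt (p := p) (by omega)]; simp
  · obtain rfl : k = d := by omega
    have : p.coeff k = 1 := by rw [← hd]; exact hp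
    simp [this]

lemma decomp (d : ℕ) : ∀ f : Polynomial (ZMod 2), f.degree < d →
    ∃ g : Polynomial (ZMod 2), sig g = g ∧ g.degree < d ∧ f - g ∈ MP := by
  induction d with
  | zero =>
    intro f hf
    have : f = 0 := by
      rw [degree_lt_iff_coeff_zero] at hf
      ext k; simpa using hf k (Nat.zero_le _)
    exact ⟨0, by simp, by simp, by simp [this]⟩
  | succ d ih =>
    intro f hf
    by_cases hr : d % 4 = 2
    · have hm : (vP ^ (d / 2)).Monic := v_monic.pow _
      have hd : (vP ^ (d / 2)).natDegree = d := by
        rw [v_monic.natDegree_pow, v_deg]; omega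
      obtain ⟨g, h1, h2, h3⟩ := ih _ (sub_lead f _ d hf hm hd)
      refine ⟨g + f.coeff d • vP ^ (d / 2), by simp [h1, sig_v], ?_, ?_⟩
      · rw [degree_lt_iff_coeff_zero] at h2 ⊢
        intro k hk
        rw [coeff_add, coeff_smul, h2 k (by omega),
          coeff_eq_zero_of_natDegree_lt (p := vP ^ (d / 2)) (by omega)]
        simp
      · convert h3 using 1; ring
    · have hm : (uP ^ (d / 4) * X ^ (d % 4)).Monic := (u_monic.pow _).mul (monic_X_pow _)
      have hd : (uP ^ (d / 4) * X ^ (d % 4)).natDegree = d := by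
        rw [(u_monic.pow _).natDegree_mul (monic_X_pow _), u_monic.natDegree_pow, u_deg,
          natDegree_X_pow]; omega
      obtain ⟨g, h1, h2, h3⟩ := ih _ (sub_lead f _ d hf hm hd)
      refine ⟨g, h1, h2.trans (by exact_mod_cast Nat.lt_succ_self d), ?_⟩
      have h4 : uP ^ (d / 4) * X ^ (d % 4) ∈ MP :=
        Submodule.subset_span ⟨d / 4, d % 4, by omega, rfl⟩
      have := MP.add_mem h3 (MP.smul_mem (f.coeff d) h4)
      convert this using 1; ring

lemma exists_ker (m : ℕ) : ∃ f : Polynomial (ZMod 2), sig f = f ∧ f ∈ MP ∧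
    (f - X ^ (4 * m)).degree < ((4 * m : ℕ) : WithBot ℕ) := by
  have hv : (vP ^ (2 * m)).Monic := v_monic.pow _
  have hvd : (vP ^ (2 * m)).natDegree = 4 * m := by
    rw [v_monic.natDegree_pow, v_deg]; omega
  have hu : (uP ^ m).Monic := u_monic.pow _
  have hud : (uP ^ m).natDegree = 4 * m := by
    rw [u_monic.natDegree_pow, u_deg]; omega
  have key : ∀ p : Polynomial (ZMod 2), p.Monic → p.natDegree = 4 * m →
      (vP ^ (2 * m) - p).degree < (4 * m : ℕ) := by
    intro p hp hd
    have h1 : (vP ^ (2 * m)).coeff (4 * m) = 1 := by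
      rw [← hvd]; exact hv
    have := sub_lead (vP ^ (2 * m)) p (4 * m)
      (degree_le_natDegree.trans_lt (by rw [hvd]; exact_mod_cast Nat.lt_succ_self _)) hp hd
    rwa [h1, one_smul] at this
  obtain ⟨g, h1, h2, h3⟩ := decomp (4 * m) _ (key _ hu hud)
  refine ⟨vP ^ (2 * m) - g, by simp [h1, sig_v], ?_, ?_⟩
  · have h4 : uP ^ m ∈ MP := Submodule.subset_span ⟨m, 0, by simp, by simp⟩
    have := MP.add_mem h3 h4
    convert this using 1; ring
  · have := (degree_sub_le (vP ^ (2 * m) - X ^ (4 * m)) g).trans_lt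
      (max_lt (key _ (monic_X_pow _) (natDegree_X_pow _)) h2)
    rwa [sub_right_comm] at this

theorem stmt9 (C : ℕ → Polynomial (ZMod 2))
    (hC0 : C 0 = 0) (hC1 : C 1 = 1) (hC2 : C 2 = X) (hC3 : C 3 = X ^ 2)
    (hrec : ∀ n, C (n + 4) = C (n + 3) + (X ^ 4 + X ^ 3 + X ^ 2 + X) * C n + X ^ n * (X ^ 2 + X)) :
    ∀ m : ℕ, C (4 * m) ∈ Submodule.span (ZMod 2) (C '' Set.Iio (4 * m)) := by
  intro m
  let T : Polynomial (ZMod 2) →ₗ[ZMod 2] Polynomial (ZMod 2) :=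
    (Polynomial.basisMonomials (ZMod 2)).constr (ZMod 2) C
  have hT : ∀ n, T (X ^ n) = C n := by
    intro n
    have := (Polynomial.basisMonomials (ZMod 2)).constr_basis (ZMod 2) C n
    simp only [coe_basisMonomials, monomial_one_right_eq_X_pow] at this
    exact this
  let D : Polynomial (ZMod 2) →ₗ[ZMod 2] Polynomial (ZMod 2) := T + LinearMap.id
  have hD : ∀ f, D f = T f + f := fun f => rfl
  have hDX : ∀ n, D (X ^ n) = C n + X ^ n := fun n => by rw [hD, hT]
  have hw : ∀ f, D ((X ^ 4 + X ^ 3) * f) = uP * D f := by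
    intro f
    induction f using Polynomial.induction_on' with
    | add p q hp hq => rw [mul_add, map_add, hp, hq, map_add, mul_add]
    | monomial n a =>
      rw [← smul_X_eq_monomial, mul_smul_comm, map_smul, map_smul, mul_smul_comm]
      congr 1
      rw [add_mul, ← pow_add, ← pow_add, map_add, hDX, hDX, hDX, add_comm 4 n, add_comm 3 n, hrec,
        uP]
      linear_combination (C (n + 3) - (X ^ 3 + X ^ 2) * C n - X ^ 2 * X ^ n - X ^ 3 * X ^ n) *
        two_eq_zero'
  have hwj : ∀ j f, D ((X ^ 4 + X ^ 3) ^ j * f) = uP ^ j * D f := by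
    intro j
    induction j with
    | zero => simp
    | succ j ih => intro f; rw [pow_succ', mul_assoc, hw, ih]; ring
  have d0 : D 1 = 1 := by simpa [hC0] using hDX 0
  have d1 : D X = 1 + X := by simpa [hC1] using hDX 1
  have hM : ∀ f ∈ MP, D (sig f) = f := by
    intro f hf
    induction hf using Submodule.span_induction with
    | mem x hx =>
      obtain ⟨j, r, hr, rfl⟩ := hx
      rw [map_mul, map_pow, map_pow, sig_u, sig_X, hwj]
      congr 1
      rcases hr with rfl | rfl | rfl
      · simpa using d0
      · rw [pow_one, map_add, d0, d1]
        linear_combination two_eq_zero'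
      · have : ((X + 1) ^ 3 : Polynomial (ZMod 2)) = X ^ 3 + X ^ 2 + X + 1 := by
          linear_combination (X ^ 2 + X) * two_eq_zero'
        rw [this, map_add, map_add, map_add, hDX, hDX, d0, d1, hC2, hC3]
        linear_combination (X ^ 2 + X + 1) * two_eq_zero'
    | zero => simp
    | add x y _ _ hx hy => rw [map_add, map_add, hx, hy]
    | smul a x _ hx => rw [map_smul, map_smul, hx]
  obtain ⟨f, h1, h2, h3⟩ := exists_ker m
  have h4 : T f = 0 := by
    have := hM f h2
    rw [h1, hD] at this
    simpa using this
  have h5 : C (4 * m) = - T (f - X ^ (4 * m)) := by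
    rw [map_sub, h4, hT]; simp
  rw [h5]
  apply Submodule.neg_mem
  generalize f - X ^ (4 * m) = h at h3
  rw [h.as_sum_support, map_sum]
  refine Submodule.sum_mem _ fun k hk => ?_
  rw [← smul_X_eq_monomial, map_smul, hT]
  refine Submodule.smul_mem _ _ (Submodule.subset_span ⟨k, ?_, rfl⟩)
  by_contra hlt
  rw [degree_lt_iff_coeff_zero] at h3
  exact (mem_support_iff.mp hk) (h3 k (by simpa using hlt))
end

section
/- Fix m ≥ 0 and let L* be the Z/2-subspace of Z/2[r] consisting of all (r^2 + r)·g(r^2) where g ∈ Z/2[t] has degree ≤ 4m + 3. Then U maps L* into L*, and the kernel K_m of U + I acting on L* has Z/2-dimension exactly m + 1. -/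
open Polynomial

noncomputable def Lstar (m : ℕ) : Submodule (ZMod 2) (Polynomial (ZMod 2)) :=
  Submodule.span (ZMod 2)
    {p | ∃ g : Polynomial (ZMod 2), g.natDegree ≤ 4 * m + 3 ∧ p = (X ^ 2 + X) * g.comp (X ^ 2)}

namespace S15

abbrev R := Polynomial (ZMod 2)

lemma two_R : (2 : R) = 0 := by
  have : (2 : R) = C (2 : ZMod 2) := (map_ofNat C 2).symm
  rw [this]
  have h : (2 : ZMod 2) = 0 := by decide
  rw [h, C_0]

noncomputable def F : R := X * (X + 1) ^ 3
noncomputable def G : R := X ^ 3 * (X + 1)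
noncomputable def s : R := X ^ 2 + X

lemma F_comp : F.comp (X + 1) = G := by
  have := two_R
  simp only [F, G, mul_comp, pow_comp, add_comp, X_comp, one_comp]
  have h : (X + 1 + 1 : R) = X := by grind
  rw [h]; ring

lemma s_comp : s.comp (X + 1) = s := by
  have := two_R
  simp only [s, pow_comp, add_comp, X_comp]
  grind

lemma ww (f : R) : (f.comp (X + 1)).comp (X + 1) = f := by
  have := two_R
  have h : (X + 1 + 1 : R) = X := by grind
  rw [comp_assoc, add_comp, X_comp, one_comp, h, comp_X]

lemma F_monic : F.Monic := by
  unfold F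
  exact monic_X.mul ((monic_X_add_C (1 : ZMod 2)).pow 3)

lemma G_monic : G.Monic := by
  unfold G
  exact (monic_X.pow 3).mul (monic_X_add_C (1 : ZMod 2))

lemma F_deg : F.natDegree = 4 := by
  unfold F
  have h : (X + 1 : R) = X + C 1 := by simp
  rw [h, natDegree_mul X_ne_zero (pow_ne_zero _ (X_add_C_ne_zero _)), natDegree_pow,
    natDegree_X_add_C, natDegree_X]

lemma G_deg : G.natDegree = 4 := by
  unfold G
  have h : (X + 1 : R) = X + C 1 := by simp
  rw [h, natDegree_mul (pow_ne_zero _ X_ne_zero) (X_add_C_ne_zero _), natDegree_pow,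
    natDegree_X_add_C, natDegree_X]

lemma s_deg : s.natDegree = 2 := by
  unfold s; compute_degree!

lemma low (p : R) (hp : p.natDegree < 4) : p = C (p.coeff 0) + C (p.coeff 1) * X
    + C (p.coeff 2) * X ^ 2 + C (p.coeff 3) * X ^ 3 := by
  conv_lhs => rw [p.as_sum_range_C_mul_X_pow' hp]
  simp [Finset.sum_range_succ]

/-- invariant polynomials -/
lemma invar (n : ℕ) : ∀ g : R, g.natDegree < n → g.comp (X + 1) = g →
    ∃ h : R, g = h.comp s := by
  induction n with
  | zero => intro g h; omega
  | succ n ih =>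
    intro g hg hw
    by_cases h0 : g.natDegree = 0
    · rw [natDegree_eq_zero] at h0
      obtain ⟨c, rfl⟩ := h0
      exact ⟨C c, by simp⟩
    have hs : s.Monic := by
      unfold s; monicity!
    have hdm := modByMonic_add_div g s
    have hr : (g %ₘ s).natDegree < 2 := by
      have := natDegree_modByMonic_lt g hs (by intro h; have := s_deg; rw [h] at this; simp at this)
      rwa [s_deg] at this
    have hr2 : g %ₘ s = C ((g %ₘ s).coeff 0) + C ((g %ₘ s).coeff 1) * X := by
      conv_lhs => rw [(g %ₘ s).as_sum_range_C_mul_X_pow' hr]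
      simp [Finset.sum_range_succ]
    set c := (g %ₘ s).coeff 0
    set d := (g %ₘ s).coeff 1
    set q := g /ₘ s with hq
    rw [hr2] at hdm
    have e0 : g.eval 0 = c := by rw [← hdm]; simp [s]
    have e1 : g.eval 1 = c + d := by
      rw [← hdm]; simp [s]
      left; decide
    have e2 : g.eval 1 = g.eval 0 := by
      conv_rhs => rw [← hw]
      simp
    have hd : d = 0 := by
      rw [e0, e1] at e2; simpa using e2
    rw [hd] at hdm
    simp only [C_0, zero_mul, add_zero] at hdm
    have hs0 : s ≠ 0 := hs.ne_zero
    have hqw : q.comp (X + 1) = q := by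
      have := hw
      rw [← hdm] at this
      simp only [add_comp, C_comp, mul_comp, s_comp] at this
      exact mul_left_cancel₀ hs0 (add_left_cancel this)
    have hqd : q.natDegree < n := by
      rw [hq, natDegree_divByMonic g hs, s_deg]; omega
    obtain ⟨h, hh⟩ := ih q hqd hqw
    refine ⟨C c + X * h, ?_⟩
    rw [← hdm]
    simp only [add_comp, C_comp, mul_comp, X_comp, ← hh]

/-- no common polynomial -/
lemma noPF (n : ℕ) : ∀ (P : R) (k : ℕ), P.natDegree < n → P.coeff 0 = 0 →
    (X + 1) ^ k * P.comp F = X ^ k * P.comp G → P = 0 := by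
  induction n with
  | zero => intro P k h; omega
  | succ n ih =>
    intro P k hP h0 h
    obtain ⟨P1, rfl⟩ := X_dvd_iff.mpr h0
    by_cases hP1 : P1 = 0
    · simp [hP1]
    rw [natDegree_mul X_ne_zero hP1, natDegree_X] at hP
    simp only [mul_comp, X_comp] at h
    have hX1 : (X + 1 : R) ≠ 0 := by
      have := X_add_C_ne_zero (1 : ZMod 2); simpa using this
    have h' : (X + 1) ^ (k + 2) * P1.comp F = X ^ (k + 2) * P1.comp G := by
      apply mul_left_cancel₀ (mul_ne_zero (X_ne_zero (R := ZMod 2)) hX1)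
      unfold F G at *
      linear_combination h
    have h1 : P1.coeff 0 = 0 := by
      have := congrArg (eval 0) h'
      simpa [eval_comp, F, coeff_zero_eq_eval_zero] using this
    rw [ih P1 (k + 2) (by omega) h1 h', mul_zero]

noncomputable def ab : ℕ → R × R
  | 0 => (0, 0)
  | 1 => (1, 0)
  | (n + 2) => ((ab (n + 1)).2 + X * (ab n).1, X * ((ab n).1 + (ab n).2))

lemma coeff_X_mul_vanish {p : R} {k : ℕ} (h : ∀ i, k ≤ i → p.coeff i = 0) :
    ∀ i, k + 1 ≤ i → (X * p).coeff i = 0 := by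
  intro i hi
  obtain ⟨j, rfl⟩ : ∃ j, i = j + 1 := ⟨i - 1, by omega⟩
  rw [coeff_X_mul]; exact h j (by omega)

lemma ab_deg (k : ℕ) :
    (∀ i, k ≤ i → (ab (2 * k)).1.coeff i = 0) ∧ (∀ i, k ≤ i → (ab (2 * k)).2.coeff i = 0) ∧
    (∀ i, k + 1 ≤ i → (ab (2 * k + 1)).1.coeff i = 0) ∧ (ab (2 * k + 1)).1.coeff k = 1 ∧
    (∀ i, k + 1 ≤ i → (ab (2 * k + 1)).2.coeff i = 0) := by
  induction k with
  | zero =>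
    simp only [ab, mul_zero, zero_add]
    refine ⟨by simp, by simp, ?_, by simp, by simp⟩
    intro i hi
    rw [coeff_one, if_neg (by omega)]
  | succ k ih =>
    obtain ⟨i1, i2, i3, i4, i5⟩ := ih
    have e1 : ab (2 * (k + 1)) = ((ab (2 * k + 1)).2 + X * (ab (2 * k)).1,
      X * ((ab (2 * k)).1 + (ab (2 * k)).2)) := rfl
    have e2 : ab (2 * (k + 1) + 1) = ((ab (2 * (k + 1))).2 + X * (ab (2 * k + 1)).1,
      X * ((ab (2 * k + 1)).1 + (ab (2 * k + 1)).2)) := rfl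
    have j1 : ∀ i, k + 1 ≤ i → (ab (2 * (k + 1))).1.coeff i = 0 := by
      intro i hi
      rw [e1, coeff_add, i5 i hi, coeff_X_mul_vanish i1 i hi, add_zero]
    have j2 : ∀ i, k + 1 ≤ i → (ab (2 * (k + 1))).2.coeff i = 0 := by
      rw [e1]
      apply coeff_X_mul_vanish
      intro i hi
      rw [coeff_add, i1 i hi, i2 i hi, add_zero]
    refine ⟨j1, j2, ?_, ?_, ?_⟩
    · intro i hi
      rw [e2, coeff_add, j2 i (by omega), coeff_X_mul_vanish i3 i hi, add_zero]
    · rw [e2, coeff_add, j2 _ le_rfl, coeff_X_mul, i4, zero_add]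
    · rw [e2]
      apply coeff_X_mul_vanish
      intro i hi
      rw [coeff_add, i3 i hi, i5 i hi, add_zero]

lemma a_mem (m j : ℕ) (hj : j < 2 * m) : (ab j).1 ∈ degreeLT (ZMod 2) m := by
  rw [mem_degreeLT, degree_lt_iff_coeff_zero]
  intro i hi
  obtain ⟨k, rfl | rfl⟩ := Nat.even_or_odd' j
  · exact (ab_deg k).1 i (by omega)
  · exact (ab_deg k).2.2.1 i (by omega)

noncomputable def phi : R →ₗ[ZMod 2] R :=
  (LinearMap.mulLeft (ZMod 2) s) ∘ₗ (aeval (R := ZMod 2) (s ^ 2)).toLinearMap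

lemma phi_apply (h : R) : phi h = s * h.comp (s ^ 2) := by
  simp [phi, comp, aeval_def]

noncomputable def theta : R →ₗ[ZMod 2] R :=
  (LinearMap.mulLeft (ZMod 2) F) ∘ₗ (aeval (R := ZMod 2) (F ^ 2)).toLinearMap

lemma theta_apply (h : R) : theta h = F * h.comp (F ^ 2) := by
  simp [theta, comp, aeval_def]

lemma mul_comp_inj (a b : R) (ha : a ≠ 0) (hb : 0 < b.natDegree) (h : R)
    (e : a * h.comp b = 0) : h = 0 := by
  have h1 := (mul_eq_zero.mp e).resolve_left ha
  have h2 := congrArg natDegree h1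
  rw [natDegree_comp, natDegree_zero] at h2
  have h3 : h.natDegree = 0 := by
    rcases Nat.mul_eq_zero.mp h2 with h | h <;> omega
  obtain ⟨c, rfl⟩ := natDegree_eq_zero.mp h3
  simpa using h1

lemma s_ne : s ≠ 0 := by
  intro h; have := s_deg; rw [h] at this; simp at this

lemma phi_inj : Function.Injective phi := by
  rw [← LinearMap.ker_eq_bot, LinearMap.ker_eq_bot']
  intro h hh
  rw [phi_apply] at hh
  exact mul_comp_inj _ _ s_ne (by rw [natDegree_pow, s_deg]; norm_num) _ hh

lemma theta_inj : Function.Injective theta := by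
  rw [← LinearMap.ker_eq_bot, LinearMap.ker_eq_bot']
  intro h hh
  rw [theta_apply] at hh
  exact mul_comp_inj _ _ F_monic.ne_zero (by rw [natDegree_pow, F_deg]; norm_num) _ hh

lemma mem_Lstar (m : ℕ) (f : R) : f ∈ Lstar m ↔
    ∃ g : R, g.natDegree ≤ 4 * m + 3 ∧ f = s * g.comp (X ^ 2) := by
  constructor
  · intro h
    unfold Lstar at h
    induction h using Submodule.span_induction with
    | mem x h => exact h
    | zero => exact ⟨0, by simp, by simp⟩
    | add x y _ _ hx hy =>
      obtain ⟨g, hg, rfl⟩ := hx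
      obtain ⟨g', hg', rfl⟩ := hy
      exact ⟨g + g', natDegree_add_le_of_degree_le hg hg', by rw [add_comp]; ring⟩
    | smul c x _ hx =>
      obtain ⟨g, hg, rfl⟩ := hx
      exact ⟨c • g, (natDegree_smul_le _ _).trans hg, by rw [smul_comp, mul_smul_comm]⟩
  · rintro ⟨g, hg, rfl⟩
    exact Submodule.subset_span ⟨g, hg, rfl⟩

lemma sq_comp (p : R) : p.comp (X ^ 2) = p ^ 2 := by
  rw [← expand_eq_comp_X_pow, ZMod.expand_card]

section
variable (U : R →ₗ[ZMod 2] R)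
    (hsemi : ∀ f, U (G * f) = F * U f)
    (h0 : U 1 = 1) (h1 : U X = X) (h2 : U (X ^ 2) = X ^ 2)
    (h3 : U (X ^ 3) = X ^ 3 + X ^ 2 + X)

include hsemi h0 h1 h2 h3

lemma U_low (c0 c1 c2 c3 : ZMod 2) : U (C c0 + C c1 * X + C c2 * X ^ 2 + C c3 * X ^ 3) =
    C c0 + C c1 * X + C c2 * X ^ 2 + C c3 * (X ^ 3 + X ^ 2 + X) := by
  have e : (C c0 + C c1 * X + C c2 * X ^ 2 + C c3 * X ^ 3 : R) =
    c0 • 1 + c1 • X + c2 • X ^ 2 + c3 • X ^ 3 := by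
    simp only [smul_eq_C_mul, mul_one]
  rw [e]
  simp only [map_add, map_smul, h0, h1, h2, h3]
  simp only [smul_eq_C_mul, mul_one]

lemma T_F (f : R) : F * f + U ((F * f).comp (X + 1)) = F * (f + U (f.comp (X + 1))) := by
  rw [mul_comp, F_comp, hsemi]; ring

lemma T_mem (n : ℕ) : ∀ f : R, f.natDegree < n → ∃ P : R, f + U (f.comp (X + 1)) = P.comp F := by
  induction n with
  | zero => intro f h; omega
  | succ n ih =>
    intro f hf
    have two := two_R
    have hlow : ∀ p : R, p.natDegree < 4 → ∃ P : R, p + U (p.comp (X + 1)) = P.comp F := by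
      intro p hp
      rw [low p hp]
      generalize p.coeff 0 = c0
      generalize p.coeff 1 = c1
      generalize p.coeff 2 = c2
      generalize p.coeff 3 = c3
      refine ⟨C (c1 + c2 + c3), ?_⟩
      have e : (C c0 + C c1 * X + C c2 * X ^ 2 + C c3 * X ^ 3 : R).comp (X + 1) =
        C (c0 + c1 + c2 + c3) + C (c1 + c3) * X + C (c2 + c3) * X ^ 2 + C c3 * X ^ 3 := by
        simp only [add_comp, mul_comp, C_comp, X_comp, pow_comp, C_add]
        grind
      rw [e, U_low U hsemi h0 h1 h2 h3]
      simp only [C_comp]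
      simp only [C_add]
      clear e ih hf hsemi h0 h1 h2 h3
      grind
    by_cases h4 : f.natDegree < 4
    · exact hlow f h4
    obtain ⟨P, hP⟩ := hlow (f %ₘ F) (by
      have := natDegree_modByMonic_lt f F_monic
        (by intro h; have := F_deg; rw [h] at this; simp at this)
      rwa [F_deg] at this)
    obtain ⟨Q, hQ⟩ := ih (f /ₘ F) (by rw [natDegree_divByMonic f F_monic, F_deg]; omega)
    refine ⟨P + X * Q, ?_⟩
    conv_lhs => rw [← modByMonic_add_div f F]
    have e := T_F U hsemi h0 h1 h2 h3 (f /ₘ F)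
    rw [hQ] at e
    rw [add_comp, map_add, add_comp, mul_comp X Q, X_comp, ← hP, ← e]
    ring

lemma U_Lstar (n : ℕ) : ∀ g : R, g.natDegree ≤ 4 * n + 3 →
    ∃ g' : R, g'.natDegree ≤ 4 * n + 3 ∧ U (s * g.comp (X ^ 2)) = s * g'.comp (X ^ 2) := by
  have two := two_R
  have hlow : ∀ g : R, g.natDegree < 4 →
    ∃ g' : R, g'.natDegree ≤ 3 ∧ U (s * g.comp (X ^ 2)) = s * g'.comp (X ^ 2) := by
    intro p hp
    rw [low p hp]
    generalize p.coeff 0 = c0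
    generalize p.coeff 1 = c1
    generalize p.coeff 2 = c2
    generalize p.coeff 3 = c3
    refine ⟨C c0 + C c1 * (X + 1) + C c2 * (X ^ 2 + X) + C c3 * (X ^ 3 + X ^ 2), ?_, ?_⟩
    · compute_degree
    have e : s * (C c0 + C c1 * X + C c2 * X ^ 2 + C c3 * X ^ 3 : R).comp (X ^ 2) =
        (C 0 + C c0 * X + C c0 * X ^ 2 + C 0 * X ^ 3) + 
        G * ((C c1 + C 0 * X + C c2 * X ^ 2 + C c3 * X ^ 3) + G * (C c3 + C 0 * X + C 0 * X ^ 2 + C 0 * X ^ 3)) := by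
      simp only [add_comp, mul_comp, C_comp, X_comp, pow_comp, C_0, s, G]
      grind
    rw [e, map_add U (_ + _) (G * _), hsemi, map_add U (_ + _) (G * _), hsemi]
    simp only [U_low U hsemi h0 h1 h2 h3]
    clear e
    simp only [add_comp, mul_comp, C_comp, X_comp, pow_comp, C_0, s, F, one_comp]
    grind
  induction n with
  | zero => intro g hg; exact hlow g (by omega)
  | succ n ih =>
    intro g hg
    obtain ⟨P, hPd, hP⟩ := hlow (g %ₘ G) (by
      have := natDegree_modByMonic_lt g G_monic
        (by intro h; have := G_deg; rw [h] at this; simp at this)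
      rwa [G_deg] at this)
    obtain ⟨Q, hQd, hQ⟩ := ih (g /ₘ G) (by rw [natDegree_divByMonic g G_monic, G_deg]; omega)
    refine ⟨P + F * Q, ?_, ?_⟩
    · apply natDegree_add_le_of_degree_le (by omega)
      refine natDegree_mul_le.trans ?_
      rw [F_deg]; omega
    have e : s * g.comp (X ^ 2) = s * (g %ₘ G).comp (X ^ 2) +
      G * (G * (s * (g /ₘ G).comp (X ^ 2))) := by
      conv_lhs => rw [← modByMonic_add_div g G]
      rw [add_comp, mul_comp, sq_comp G]; ring
    rw [e, map_add, hsemi, hsemi, hP, hQ, add_comp, mul_comp, sq_comp F]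
    ring

lemma T_s (n : ℕ) : s ^ n + U (s ^ n) = s ^ n + U ((s ^ n).comp (X + 1)) := by
  rw [pow_comp, s_comp]

lemma T_rec (n : ℕ) : s ^ (n + 4) + U (s ^ (n + 4)) =
    F * (s ^ (n + 1) + U (s ^ (n + 1))) + F ^ 2 * (s ^ n + U (s ^ n)) := by
  have two := two_R
  have e : s ^ (n + 4) = F * s ^ (n + 1) + F * (F * s ^ n) := by
    have : s ^ 4 = F * s + F * F := by
      unfold s F; grind
    rw [pow_add, this]; ring
  have t1 := T_F U hsemi h0 h1 h2 h3 (s ^ (n + 1))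
  have t2 := T_F U hsemi h0 h1 h2 h3 (F * s ^ n)
  have t3 := T_F U hsemi h0 h1 h2 h3 (s ^ n)
  rw [T_s U hsemi h0 h1 h2 h3 (n + 4), T_s U hsemi h0 h1 h2 h3 (n + 1),
    T_s U hsemi h0 h1 h2 h3 n, e, add_comp, map_add]
  linear_combination t1 + t2 + F * t3

lemma T_ab (n : ℕ) : (s ^ (2 * n) + U (s ^ (2 * n)) = (ab n).2.comp (F ^ 2)) ∧
    (s ^ (2 * n + 1) + U (s ^ (2 * n + 1)) = F * (ab n).1.comp (F ^ 2)) := by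
  have two := two_R
  induction n using Nat.twoStepInduction with
  | zero =>
    simp only [ab, mul_zero, zero_add, pow_zero, pow_one, h0, zero_comp]
    refine ⟨by grind, ?_⟩
    simp only [s, map_add, h1, h2]; grind
  | one =>
    have x4 : U (X ^ 4) = X ^ 4 := by
      have e : (X ^ 4 : R) = G * 1 + X ^ 3 := by unfold G; grind
      rw [e, map_add, hsemi, h0, h3]; unfold F G; grind
    simp only [ab, mul_one, zero_comp, one_comp]
    constructor
    · have e : s ^ 2 = X ^ 4 + X ^ 2 := by unfold s; grind
      rw [e, map_add, x4, h2]; grind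
    · have e : s ^ (2 + 1) = G * X ^ 2 + G * 1 := by unfold s G; grind
      simp only [e, map_add, hsemi, h0, h1, h2, h3]
      unfold F G; grind
  | more n ih1 ih2 =>
    obtain ⟨p1, p2⟩ := ih1
    obtain ⟨p3, p4⟩ := ih2
    have e : ab (n + 2) = ((ab (n + 1)).2 + X * (ab n).1, X * ((ab n).1 + (ab n).2)) := rfl
    have r1 := T_rec U hsemi h0 h1 h2 h3 (2 * n)
    have r2 := T_rec U hsemi h0 h1 h2 h3 (2 * n + 1)
    rw [p1, p2] at r1
    rw [show 2 * n + 1 + 1 = 2 * (n + 1) by ring, p2, p3] at r2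
    rw [show 2 * (n + 2) = 2 * n + 4 by ring, r1, show 2 * n + 4 + 1 = 2 * n + 1 + 4 by ring, r2, e]
    simp only [add_comp, mul_comp, X_comp]
    constructor <;> ring

lemma psi_X (j : ℕ) : (U + LinearMap.id : R →ₗ[ZMod 2] R) (phi (X ^ j)) = theta (ab j).1 := by
  have := (T_ab U hsemi h0 h1 h2 h3 j).2
  rw [phi_apply, theta_apply, ← this, X_pow_comp, ← pow_mul, ← pow_succ']
  simp [add_comm]

lemma map_psi_le (m : ℕ) : (degreeLT (ZMod 2) (2 * m)).map ((U + LinearMap.id) ∘ₗ phi) ≤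
    (degreeLT (ZMod 2) m).map theta := by
  rw [degreeLT_eq_span_X_pow, Submodule.map_span_le]
  intro x hx
  simp only [Finset.coe_image, Set.mem_image, Finset.coe_range, Set.mem_Iio] at hx
  obtain ⟨j, hj, rfl⟩ := hx
  rw [LinearMap.comp_apply, psi_X U hsemi h0 h1 h2 h3]
  exact Submodule.mem_map_of_mem (a_mem m j hj)

lemma le_map_psi (m : ℕ) : (degreeLT (ZMod 2) m).map theta ≤
    (degreeLT (ZMod 2) (2 * m)).map ((U + LinearMap.id) ∘ₗ phi) := by
  induction m with
  | zero =>
    rintro _ ⟨g, hg, rfl⟩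
    rw [SetLike.mem_coe, mem_degreeLT] at hg
    have : g = 0 := by
      rw [← degree_eq_bot]
      exact Nat.WithBot.lt_zero_iff.mp (by simpa using hg)
    rw [this, map_zero]; exact Submodule.zero_mem _
  | succ m ih =>
    rintro _ ⟨g, hg, rfl⟩
    rw [SetLike.mem_coe, mem_degreeLT, degree_lt_iff_coeff_zero] at hg
    have hd := ab_deg m
    have hmono : (degreeLT (ZMod 2) (2 * m)) ≤ (degreeLT (ZMod 2) (2 * (m + 1))) :=
      degreeLT_mono (by omega)
    have h1' : theta (g - g.coeff m • (ab (2 * m + 1)).1) ∈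
        (degreeLT (ZMod 2) (2 * (m + 1))).map ((U + LinearMap.id) ∘ₗ phi) := by
      apply Submodule.map_mono hmono
      apply ih
      apply Submodule.mem_map_of_mem
      rw [mem_degreeLT, degree_lt_iff_coeff_zero]
      intro i hi
      rw [coeff_sub, coeff_smul]
      rcases hi.eq_or_lt with rfl | hi
      · rw [hd.2.2.2.1]; simp
      · rw [hg i hi, hd.2.2.1 i hi]; simp
    have h2' : theta (g.coeff m • (ab (2 * m + 1)).1) ∈
        (degreeLT (ZMod 2) (2 * (m + 1))).map ((U + LinearMap.id) ∘ₗ phi) := by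
      rw [map_smul, ← psi_X U hsemi h0 h1 h2 h3]
      apply Submodule.smul_mem
      refine ⟨X ^ (2 * m + 1), ?_, rfl⟩
      rw [SetLike.mem_coe]
      rw [mem_degreeLT, degree_X_pow]
      exact_mod_cast (by omega)
    have := Submodule.add_mem _ h1' h2'
    rwa [← map_add, sub_add_cancel] at this

lemma ker_form (m : ℕ) (f : R) (hf : f ∈ Lstar m) (hk : (U + LinearMap.id : R →ₗ[ZMod 2] R) f = 0) :
    ∃ h ∈ degreeLT (ZMod 2) (2 * (m + 1)), f = phi h := by
  have two := two_R
  obtain ⟨g, hg, rfl⟩ := (mem_Lstar m f).mp hf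
  set f := s * g.comp (X ^ 2) with hfdef
  obtain ⟨P, hP⟩ := T_mem U hsemi h0 h1 h2 h3 _ (f.comp (X + 1)) (Nat.lt_succ_self _)
  rw [ww] at hP
  rw [LinearMap.add_apply, LinearMap.id_apply] at hk
  have hU : U f = f := by grind
  rw [hU] at hP
  have hPw : P.comp G = P.comp F := by
    rw [← F_comp, ← comp_assoc, ← hP, add_comp, ww, add_comm]
  have hfw : f.comp (X + 1) = s * (g.comp (X ^ 2)).comp (X + 1) := by
    rw [hfdef, mul_comp, s_comp]
  have hP0 : P.coeff 0 = 0 := by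
    have := congrArg (eval 0) hP
    rw [hfw, hfdef] at this
    simp only [eval_add, eval_mul, eval_comp] at this
    simpa [s, F, coeff_zero_eq_eval_zero] using this.symm
  have hPz : P = 0 := noPF _ P 0 (Nat.lt_succ_self _) hP0 (by simp [hPw])
  rw [hPz, zero_comp] at hP
  have hinv : f.comp (X + 1) = f := by grind
  have hginv : g.comp (X + 1) = g := by
    rw [hfw, hfdef] at hinv
    have h := mul_left_cancel₀ s_ne hinv
    rw [comp_assoc, pow_comp, X_comp] at h
    have e : ((X + 1) ^ 2 : R) = (X + 1 : R).comp (X ^ 2) := by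
      rw [sq_comp]
    rw [e, ← comp_assoc, sq_comp, sq_comp] at h
    have : (g.comp (X + 1) + g) ^ 2 = 0 := by grind
    have := pow_eq_zero_iff (two_ne_zero) |>.mp this
    grind
  obtain ⟨h, hh⟩ := invar _ g (Nat.lt_succ_self _) hginv
  refine ⟨h, ?_, ?_⟩
  · rw [mem_degreeLT]
    apply lt_of_le_of_lt degree_le_natDegree
    have := congrArg natDegree hh
    rw [natDegree_comp, s_deg] at this
    exact_mod_cast (by omega)
  · rw [hfdef, phi_apply, hh, comp_assoc, sq_comp]

lemma phi_mem (m : ℕ) (h : R) (hh : h ∈ degreeLT (ZMod 2) (2 * (m + 1))) : phi h ∈ Lstar m := by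
  rw [mem_Lstar]
  refine ⟨h.comp s, ?_, ?_⟩
  · rw [natDegree_comp, s_deg]
    have : h.natDegree < 2 * (m + 1) := by
      by_cases hz : h = 0
      · simp [hz]
      · rw [mem_degreeLT] at hh
        exact (natDegree_lt_iff_degree_lt hz).mpr hh
    omega
  · rw [phi_apply, comp_assoc, sq_comp]

lemma finrank_degreeLT (n : ℕ) : Module.finrank (ZMod 2) (degreeLT (ZMod 2) n) = n := by
  rw [(degreeLTEquiv (ZMod 2) n).finrank_eq]; simp

lemma dim (m : ℕ) :
    Module.finrank (ZMod 2) ↥(Lstar m ⊓ LinearMap.ker (U + LinearMap.id)) = m + 1 := by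
  set D := degreeLT (ZMod 2) (2 * (m + 1)) with hD
  let psi : D →ₗ[ZMod 2] R := ((U + LinearMap.id) ∘ₗ phi) ∘ₗ D.subtype
  have hK : Lstar m ⊓ LinearMap.ker (U + LinearMap.id) =
      (LinearMap.ker psi).map (phi ∘ₗ D.subtype) := by
    ext f
    constructor
    · rintro ⟨hf, hk⟩
      obtain ⟨h, hh, rfl⟩ := ker_form U hsemi h0 h1 h2 h3 m f hf hk
      exact ⟨⟨h, hh⟩, hk, rfl⟩
    · rintro ⟨⟨h, hh⟩, hk, rfl⟩
      exact ⟨phi_mem U hsemi h0 h1 h2 h3 m h hh, hk⟩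
  have hinj : Function.Injective (phi ∘ₗ D.subtype) :=
    phi_inj.comp D.injective_subtype
  haveI : FiniteDimensional (ZMod 2) D := (degreeLTEquiv (ZMod 2) _).symm.finiteDimensional
  have hr : LinearMap.range psi = (degreeLT (ZMod 2) (m + 1)).map theta := by
    rw [LinearMap.range_comp, Submodule.range_subtype]
    exact le_antisymm (map_psi_le U hsemi h0 h1 h2 h3 _) (le_map_psi U hsemi h0 h1 h2 h3 _)
  have hrn := LinearMap.finrank_range_add_finrank_ker psi
  rw [hr, ← (Submodule.equivMapOfInjective theta theta_inj _).finrank_eq,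
    finrank_degreeLT U hsemi h0 h1 h2 h3, finrank_degreeLT U hsemi h0 h1 h2 h3] at hrn
  rw [hK, ← (Submodule.equivMapOfInjective _ hinj _).finrank_eq]
  omega

end

end S15

theorem stmt15 (U : Polynomial (ZMod 2) →ₗ[ZMod 2] Polynomial (ZMod 2))
    (hsemi : ∀ f, U (X ^ 3 * (X + 1) * f) = X * (X + 1) ^ 3 * U f)
    (h0 : U 1 = 1) (h1 : U X = X) (h2 : U (X ^ 2) = X ^ 2)
    (h3 : U (X ^ 3) = X ^ 3 + X ^ 2 + X) (m : ℕ) :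
    (∀ f ∈ Lstar m, U f ∈ Lstar m) ∧
    Module.finrank (ZMod 2) ↥(Lstar m ⊓ LinearMap.ker (U + LinearMap.id)) = m + 1 := by
  refine ⟨?_, S15.dim U hsemi h0 h1 h2 h3 m⟩
  intro f hf
  obtain ⟨g, hg, rfl⟩ := (S15.mem_Lstar m f).mp hf
  obtain ⟨g', hg', e⟩ := S15.U_Lstar U hsemi h0 h1 h2 h3 m g hg
  rw [e]
  exact (S15.mem_Lstar m _).mpr ⟨g', hg', rfl⟩
end

section
/- With L* and K_m as defined, every nonzero element of K_m has degree (in r) congruent to 2 mod 8, and for each m' with 0 ≤ m' ≤ m there is an element of K_m of degree 8m' + 2 in r. Equivalently, K_m has a Z/2-basis consisting of elements of degrees 2, 10, 18, ..., 8m + 2. -/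
open Polynomial

/-- images of `t^n` under the descended operator -/
noncomputable def hh : ℕ → (ZMod 2)[X]
  | 0 => 1
  | 1 => X + 1
  | 2 => X ^ 2 + X
  | 3 => X ^ 3 + X ^ 2
  | n + 4 => hh (n + 3) + (X ^ 4 + X ^ 3 + X ^ 2 + X) * hh n

/-- correction terms for odd powers of `r^2+r` -/
noncomputable def cc : ℕ → (ZMod 2)[X]
  | 0 => 0
  | 1 => 1
  | 2 => 0
  | 3 => X
  | n + 4 => X ^ 2 * cc n + X * cc (n + 1)

lemma hh_top (n : ℕ) : (hh n).natDegree ≤ n ∧ (hh n).coeff n = 1 := by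
  induction n using Nat.strong_induction_on with
  | _ n ih =>
    match n with
    | 0 => simp [hh]
    | 1 => refine ⟨by rw [hh]; compute_degree, by simp [hh, coeff_X, coeff_one]⟩
    | 2 => refine ⟨by rw [hh]; compute_degree, by simp [hh, coeff_X]⟩
    | 3 => refine ⟨by rw [hh]; compute_degree, by simp [hh, coeff_X_pow]⟩
    | n + 4 =>
      obtain ⟨a1, a2⟩ := ih n (by omega)
      obtain ⟨b1, b2⟩ := ih (n + 3) (by omega)
      have hF : (X ^ 4 + X ^ 3 + X ^ 2 + X : (ZMod 2)[X]).natDegree ≤ 4 := by compute_degree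
      constructor
      · rw [hh]
        refine natDegree_add_le_of_degree_le (by omega) ?_
        exact (natDegree_mul_le).trans (by omega)
      · rw [hh, coeff_add, coeff_eq_zero_of_natDegree_lt (by omega), add_comm n 4,
          coeff_mul_add_eq_of_natDegree_le hF a1, a2]
        simp [coeff_X, coeff_X_pow]

lemma hh_sub (n : ℕ) : (hh (n + 1)).coeff n = if (n + 1) % 4 = 0 then 0 else 1 := by
  induction n using Nat.strong_induction_on with
  | _ n ih =>
    match n with
    | 0 => simp [hh]
    | 1 => simp [hh, coeff_X]
    | 2 => simp [hh, coeff_X_pow]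
    | 3 => simp [hh, coeff_X_pow, coeff_X]; decide
    | n + 4 =>
      have e : hh (n + 4 + 1) = hh (n + 4) + (X ^ 4 + X ^ 3 + X ^ 2 + X) * hh (n + 1) := by
        rw [show n + 4 + 1 = (n + 1) + 4 by omega, hh]
      have := ih n (by omega)
      have t := (hh_top (n + 4)).2
      have t1 := (hh_top (n + 1)).2
      have d1 := (hh_top (n + 1)).1
      have c1 : ((X ^ 4 : (ZMod 2)[X]) * hh (n + 1)).coeff (n + 4) = (hh (n + 1)).coeff n := by
        rw [mul_comm, coeff_mul_X_pow]
      have c2 : ((X ^ 3 : (ZMod 2)[X]) * hh (n + 1)).coeff (n + 4) = (hh (n + 1)).coeff (n + 1) := by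
        rw [mul_comm, show n + 4 = (n + 1) + 3 by omega, coeff_mul_X_pow]
      have c3 : ((X ^ 2 : (ZMod 2)[X]) * hh (n + 1)).coeff (n + 4) = 0 := by
        rw [mul_comm, show n + 4 = (n + 2) + 2 by omega, coeff_mul_X_pow]
        exact coeff_eq_zero_of_natDegree_lt (by omega)
      have c4 : ((X : (ZMod 2)[X]) * hh (n + 1)).coeff (n + 4) = 0 := by
        rw [mul_comm, show n + 4 = (n + 3) + 1 by omega, coeff_mul_X]
        exact coeff_eq_zero_of_natDegree_lt (by omega)
      rw [e, add_mul, add_mul, add_mul]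
      simp only [coeff_add, c1, c2, c3, c4, t, t1, this]
      rw [show (n + 4 + 1) % 4 = (n + 1) % 4 by omega]
      split_ifs <;> decide

lemma cc_odd (j : ℕ) : (cc (2 * j + 1)).natDegree ≤ j ∧ (cc (2 * j + 1)).coeff j = 1 ∧
    (cc (2 * j)).degree < j := by
  induction j using Nat.strong_induction_on with
  | _ j ih =>
    match j with
    | 0 => simp [cc]
    | 1 => simp [cc]
    | j + 2 =>
      obtain ⟨a1, a2, a3⟩ := ih j (by omega)
      obtain ⟨b1, b2, b3⟩ := ih (j + 1) (by omega)
      have e1 : cc (2 * (j + 2) + 1) = X ^ 2 * cc (2 * j + 1) + X * cc (2 * (j + 1)) := by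
        rw [show 2 * (j + 2) + 1 = (2 * j + 1) + 4 by omega, cc]
        rfl
      have e2 : cc (2 * (j + 2)) = X ^ 2 * cc (2 * j) + X * cc (2 * j + 1) := by
        rw [show 2 * (j + 2) = (2 * j) + 4 by omega, cc]
      rw [degree_lt_iff_coeff_zero] at a3 b3 ⊢
      rw [natDegree_le_iff_coeff_eq_zero] at a1 b1 ⊢
      rw [e1, e2, mul_comm (X ^ 2), mul_comm X, mul_comm (X ^ 2), mul_comm X]
      refine ⟨?_, ?_, ?_⟩
      · intro N hN
        obtain ⟨M, rfl⟩ : ∃ M, N = M + 2 := ⟨N - 2, by omega⟩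
        rw [coeff_add, coeff_mul_X_pow, coeff_mul_X, a1 _ (by omega), b3 _ (by omega), add_zero]
      · rw [coeff_add, coeff_mul_X_pow, coeff_mul_X, a2, b3 _ (by omega), add_zero]
      · intro N hN
        obtain ⟨M, rfl⟩ : ∃ M, N = M + 2 := ⟨N - 2, by omega⟩
        rw [coeff_add, coeff_mul_X_pow, coeff_mul_X, a3 _ (by omega), a1 _ (by omega), add_zero]

/-- linear extension of `cc` -/
noncomputable def Clin : (ZMod 2)[X] →ₗ[ZMod 2] (ZMod 2)[X] :=
  Polynomial.lsum fun n => (LinearMap.id : ZMod 2 →ₗ[ZMod 2] ZMod 2).smulRight (cc n)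

lemma Clin_X (n : ℕ) : Clin (X ^ n) = cc n := by
  rw [X_pow_eq_monomial, Clin, lsum_apply, sum_monomial_index] <;> simp

lemma Clin_surj (k : ℕ) : ∀ c : (ZMod 2)[X], c.degree < k →
    ∃ a : (ZMod 2)[X], a.degree < (2 * k : ℕ) ∧ Clin a = c := by
  induction k with
  | zero => 
    intro c hc
    have : c = 0 := by
      rw [← degree_eq_bot]; simpa using hc
    exact ⟨0, by simp, by simp [this]⟩
  | succ k ih =>
    intro c hc
    obtain ⟨o1, o2, -⟩ := cc_odd k
    obtain ⟨a, ha, hca⟩ := ih (c - c.coeff k • cc (2 * k + 1)) (by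
      rw [degree_lt_iff_coeff_zero] at hc ⊢
      intro N hN
      rcases hN.eq_or_lt with rfl | h
      · simp [o2]
      · rw [coeff_sub, hc _ (by omega), coeff_smul,
          coeff_eq_zero_of_natDegree_lt (p := cc (2 * k + 1)) (by omega)]
        simp)
    refine ⟨a + c.coeff k • X ^ (2 * k + 1), ?_, ?_⟩
    · rw [degree_lt_iff_coeff_zero] at ha ⊢
      intro N hN
      rw [coeff_add, ha _ (by omega), coeff_smul, coeff_X_pow, if_neg (by omega)]
      simp
    · rw [map_add, map_smul, Clin_X, hca]; simp

lemma U_rec (U : Polynomial (ZMod 2) →ₗ[ZMod 2] Polynomial (ZMod 2))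
        (hsemi : ∀ f, U (X ^ 3 * (X + 1) * f) = X * (X + 1) ^ 3 * U f)
    (n : ℕ) : U (X ^ (n + 4)) = U (X ^ (n + 3)) + X * (X + 1) ^ 3 * U (X ^ n) := by
  rw [← hsemi, ← map_add]
  congr 1
  grind

lemma U_vals (U : Polynomial (ZMod 2) →ₗ[ZMod 2] Polynomial (ZMod 2))
    (hsemi : ∀ f, U (X ^ 3 * (X + 1) * f) = X * (X + 1) ^ 3 * U f)
    (h0 : U 1 = 1) (h1 : U X = X) (h2 : U (X ^ 2) = X ^ 2)
    (h3 : U (X ^ 3) = X ^ 3 + X ^ 2 + X)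
    : U (X ^ 4) = X ^ 4 ∧ U (X ^ 5) = X ^ 5 + X ^ 3 + X ^ 2 ∧
    U (X ^ 6) = X ^ 6 + X ^ 4 + X ^ 2 ∧ U (X ^ 7) = X ^ 7 + X ^ 6 + X ^ 5 ∧
    U (X ^ 8) = X ^ 8 := by
  have r0 := U_rec U hsemi 0
  have r1 := U_rec U hsemi 1
  have r2 := U_rec U hsemi 2
  have r3 := U_rec U hsemi 3
  have r4 := U_rec U hsemi 4
  simp only [pow_zero, pow_one, h0, h1, h2, h3, Nat.reduceAdd] at r0 r1 r2 r3 r4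
  have e4 : U (X ^ 4) = X ^ 4 := by rw [r0]; grind
  have e5 : U (X ^ 5) = X ^ 5 + X ^ 3 + X ^ 2 := by rw [r1, e4]; grind
  have e6 : U (X ^ 6) = X ^ 6 + X ^ 4 + X ^ 2 := by rw [r2, e5]; grind
  have e7 : U (X ^ 7) = X ^ 7 + X ^ 6 + X ^ 5 := by rw [r3, e6]; grind
  have e8 : U (X ^ 8) = X ^ 8 := by rw [r4, e7, e4]; grind
  exact ⟨e4, e5, e6, e7, e8⟩

lemma U_hh (U : Polynomial (ZMod 2) →ₗ[ZMod 2] Polynomial (ZMod 2))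
    (hsemi : ∀ f, U (X ^ 3 * (X + 1) * f) = X * (X + 1) ^ 3 * U f)
    (h0 : U 1 = 1) (h1 : U X = X) (h2 : U (X ^ 2) = X ^ 2)
    (h3 : U (X ^ 3) = X ^ 3 + X ^ 2 + X)
    (n : ℕ) : U ((X ^ 2 + X) * (X ^ 2) ^ n) = (X ^ 2 + X) * (hh n).comp (X ^ 2) := by
  obtain ⟨e4, e5, e6, e7, e8⟩ := U_vals U hsemi h0 h1 h2 h3
  induction n using Nat.strong_induction_on with
  | _ n ih =>
    match n with
    | 0 => simp [hh, h1, h2]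
    | 1 =>
      rw [show ((X ^ 2 + X) * (X ^ 2) ^ 1 : (ZMod 2)[X]) = X ^ 4 + X ^ 3 by ring, map_add, e4, h3]
      simp [hh]; grind
    | 2 =>
      rw [show ((X ^ 2 + X) * (X ^ 2) ^ 2 : (ZMod 2)[X]) = X ^ 6 + X ^ 5 by ring, map_add, e6, e5]
      simp [hh]; grind
    | 3 =>
      rw [show ((X ^ 2 + X) * (X ^ 2) ^ 3 : (ZMod 2)[X]) = X ^ 8 + X ^ 7 by ring, map_add, e8, e7]
      simp [hh]; grind
    | n + 4 =>
      have i0 := ih n (by omega)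
      have i3 := ih (n + 3) (by omega)
      rw [show ((X ^ 2 + X) * (X ^ 2) ^ (n + 4) : (ZMod 2)[X]) = (X ^ 2 + X) * (X ^ 2) ^ (n + 3) +
        X ^ 3 * (X + 1) * (X ^ 3 * (X + 1) * ((X ^ 2 + X) * (X ^ 2) ^ n)) by grind,
        map_add, hsemi, hsemi, i0, i3, hh]
      simp only [add_comp, mul_comp, X_comp, pow_comp]
      grind

lemma U_cc (U : Polynomial (ZMod 2) →ₗ[ZMod 2] Polynomial (ZMod 2))
    (hsemi : ∀ f, U (X ^ 3 * (X + 1) * f) = X * (X + 1) ^ 3 * U f)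
    (h0 : U 1 = 1) (h1 : U X = X) (h2 : U (X ^ 2) = X ^ 2)
    (h3 : U (X ^ 3) = X ^ 3 + X ^ 2 + X)
    (n : ℕ) : U ((X ^ 2 + X) * ((X ^ 2 + X) ^ 2) ^ n) =
    (X ^ 2 + X) * ((X ^ 2 + X) ^ 2) ^ n +
      (X ^ 2 + X) * (X ^ 2 + 1) * (cc n).comp ((X * (X + 1) ^ 3) ^ 2) := by
  have hU := U_hh U hsemi h0 h1 h2 h3
  induction n using Nat.strong_induction_on with
  | _ n ih =>
    match n with
    | 0 => simp [cc, h1, h2]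
    | 1 =>
      rw [show ((X ^ 2 + X) * ((X ^ 2 + X) ^ 2) ^ 1 : (ZMod 2)[X]) =
        (X ^ 2 + X) * (X ^ 2) ^ 2 + (X ^ 2 + X) * (X ^ 2) ^ 1 by grind, map_add, hU, hU]
      simp [cc, hh]; grind
    | 2 =>
      rw [show ((X ^ 2 + X) * ((X ^ 2 + X) ^ 2) ^ 2 : (ZMod 2)[X]) =
        (X ^ 2 + X) * (X ^ 2) ^ 4 + (X ^ 2 + X) * (X ^ 2) ^ 2 by grind, map_add, hU, hU]
      simp [cc, hh]; grind
    | 3 =>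
      rw [show ((X ^ 2 + X) * ((X ^ 2 + X) ^ 2) ^ 3 : (ZMod 2)[X]) =
        (X ^ 2 + X) * (X ^ 2) ^ 6 + (X ^ 2 + X) * (X ^ 2) ^ 5 + (X ^ 2 + X) * (X ^ 2) ^ 4 +
        (X ^ 2 + X) * (X ^ 2) ^ 3 by grind, map_add, map_add, map_add, hU, hU, hU, hU]
      simp [cc, hh]; grind
    | n + 4 =>
      have i0 := ih n (by omega)
      have i1 := ih (n + 1) (by omega)
      rw [show ((X ^ 2 + X) * ((X ^ 2 + X) ^ 2) ^ (n + 4) : (ZMod 2)[X]) =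
        X ^ 3 * (X + 1) * (X ^ 3 * (X + 1) * (X ^ 3 * (X + 1) * (X ^ 3 * (X + 1) *
          ((X ^ 2 + X) * ((X ^ 2 + X) ^ 2) ^ n)))) +
        X ^ 3 * (X + 1) * (X ^ 3 * (X + 1) * ((X ^ 2 + X) * ((X ^ 2 + X) ^ 2) ^ (n + 1))) by
          rw [pow_add, pow_succ]
          generalize ((X ^ 2 + X : (ZMod 2)[X]) ^ 2) ^ n = y
          grind,
        map_add, hsemi, hsemi, hsemi, hsemi, hsemi, hsemi, i0, i1, cc]
      simp only [add_comp, mul_comp, X_comp, pow_comp]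
      rw [pow_add, pow_succ]
      generalize ((X ^ 2 + X : (ZMod 2)[X]) ^ 2) ^ n = y
      generalize (cc n).comp ((X * (X + 1) ^ 3) ^ 2) = a
      generalize (cc (n + 1)).comp ((X * (X + 1) ^ 3) ^ 2) = b
      grind


lemma mem_L {m : ℕ} {f : (ZMod 2)[X]} (hf : f ∈ Lstar m) :
    ∃ g : (ZMod 2)[X], f = (X ^ 2 + X) * g.comp (X ^ 2) := by
  induction hf using Submodule.span_induction with
  | mem x h => obtain ⟨g, -, h⟩ := h; exact ⟨g, h⟩
  | zero => exact ⟨0, by simp⟩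
  | add x y _ _ hx hy =>
    obtain ⟨g, rfl⟩ := hx
    obtain ⟨h, rfl⟩ := hy
    exact ⟨g + h, by simp [mul_add]⟩
  | smul a x _ hx =>
    obtain ⟨g, rfl⟩ := hx
    exact ⟨a • g, by simp⟩

/-- linear extension of `hh` -/
noncomputable def HH : (ZMod 2)[X] →ₗ[ZMod 2] (ZMod 2)[X] :=
  Polynomial.lsum fun n => (LinearMap.id : ZMod 2 →ₗ[ZMod 2] ZMod 2).smulRight (hh n)

lemma HH_X (n : ℕ) : HH (X ^ n) = hh n := by
  rw [X_pow_eq_monomial, HH, lsum_apply, sum_monomial_index] <;> simp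

lemma HH_coeff (g : (ZMod 2)[X]) (n : ℕ) (hg : g.natDegree = n + 1) :
    (HH g).coeff n = g.coeff n + g.coeff (n + 1) * (if (n + 1) % 4 = 0 then 0 else 1) := by
  have : HH g = ∑ i ∈ Finset.range (n + 2), g.coeff i • hh i := by
    conv_lhs => rw [g.as_sum_range' (n + 2) (by omega)]
    rw [map_sum]
    refine Finset.sum_congr rfl fun i _ => ?_
    rw [← smul_X_eq_monomial, map_smul, HH_X]
  rw [this, finsetSum_coeff, Finset.sum_range_succ, Finset.sum_range_succ,
    Finset.sum_eq_zero]
  · simp [hh_sub, (hh_top n).2]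
  · intro i hi
    have := (hh_top i).1
    rw [Finset.mem_range] at hi
    rw [coeff_smul, coeff_eq_zero_of_natDegree_lt (p := hh i) (by omega), smul_zero]

lemma U_HH (U : Polynomial (ZMod 2) →ₗ[ZMod 2] Polynomial (ZMod 2))
    (h : ∀ n : ℕ, U ((X ^ 2 + X) * (X ^ 2) ^ n) = (X ^ 2 + X) * (hh n).comp (X ^ 2))
    (g : (ZMod 2)[X]) : U ((X ^ 2 + X) * g.comp (X ^ 2)) = (X ^ 2 + X) * (HH g).comp (X ^ 2) := by
  induction g using Polynomial.induction_on' with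
  | add p q hp hq => simp only [add_comp, mul_add, map_add, hp, hq]
  | monomial n a =>
    rw [← smul_X_eq_monomial, map_smul, HH_X]
    simp only [smul_comp, mul_smul_comm, map_smul, X_pow_comp, h]

lemma U_Clin (U : Polynomial (ZMod 2) →ₗ[ZMod 2] Polynomial (ZMod 2))
    (h : ∀ n : ℕ, U ((X ^ 2 + X) * ((X ^ 2 + X) ^ 2) ^ n) =
    (X ^ 2 + X) * ((X ^ 2 + X) ^ 2) ^ n +
      (X ^ 2 + X) * (X ^ 2 + 1) * (cc n).comp ((X * (X + 1) ^ 3) ^ 2))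
    (g : (ZMod 2)[X]) : U ((X ^ 2 + X) * g.comp ((X ^ 2 + X) ^ 2)) =
      (X ^ 2 + X) * g.comp ((X ^ 2 + X) ^ 2) +
      (X ^ 2 + X) * (X ^ 2 + 1) * (Clin g).comp ((X * (X + 1) ^ 3) ^ 2) := by
  induction g using Polynomial.induction_on' with
  | add p q hp hq => simp only [add_comp, mul_add, map_add, hp, hq]; ring
  | monomial n a =>
    rw [← smul_X_eq_monomial, map_smul, Clin_X]
    simp only [smul_comp, mul_smul_comm, map_smul, X_pow_comp, h, smul_add]

lemma deg_w : (X ^ 2 + X : (ZMod 2)[X]).natDegree = 2 := by compute_degree!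

theorem stmt16 (U : Polynomial (ZMod 2) →ₗ[ZMod 2] Polynomial (ZMod 2))
    (hsemi : ∀ f, U (X ^ 3 * (X + 1) * f) = X * (X + 1) ^ 3 * U f)
    (h0 : U 1 = 1) (h1 : U X = X) (h2 : U (X ^ 2) = X ^ 2)
    (h3 : U (X ^ 3) = X ^ 3 + X ^ 2 + X) (m : ℕ) :
    (∀ f ∈ Lstar m ⊓ LinearMap.ker (U + LinearMap.id), f ≠ 0 → f.natDegree % 8 = 2) ∧
    (∀ m' : ℕ, m' ≤ m → ∃ f ∈ Lstar m ⊓ LinearMap.ker (U + LinearMap.id),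
      f ≠ 0 ∧ f.natDegree = 8 * m' + 2) := by
  have hw : (X ^ 2 + X : (ZMod 2)[X]) ≠ 0 := by
    intro h; have := deg_w; rw [h] at this; simp at this
  constructor
  · rintro f ⟨hL, hK⟩ hf
    obtain ⟨g, rfl⟩ := mem_L hL
    have hK' : U ((X ^ 2 + X) * g.comp (X ^ 2)) + (X ^ 2 + X) * g.comp (X ^ 2) = 0 := hK
    rw [U_HH U (U_hh U hsemi h0 h1 h2 h3), ← mul_add, ← add_comp] at hK'
    have h5 := (mul_eq_zero.mp hK').resolve_left hw
    have h6 : HH g + g = 0 := by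
      rw [← expand_eq_comp_X_pow] at h5
      exact (expand_eq_zero (by norm_num)).mp h5
    have hne := right_ne_zero_of_mul hf
    have hg : g.natDegree % 4 = 0 := by
      rcases hd : g.natDegree with _ | n
      · rfl
      · by_contra hc
        have h7 := congrArg (fun p => coeff p n) h6
        simp only [coeff_add, HH_coeff g n hd, if_neg hc, coeff_zero, mul_one] at h7
        have h8 : g.coeff (n + 1) = 0 := by
          have := CharTwo.add_self_eq_zero (g.coeff n)
          linear_combination h7 - this
        rw [← hd] at h8
        have h9 : g = 0 := leadingCoeff_eq_zero.mp h8
        simp [h9] at hd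
    rw [natDegree_mul hw hne, deg_w, natDegree_comp, natDegree_X_pow]
    omega
  · intro k hk
    obtain ⟨a, ha, hCa⟩ := Clin_surj k (cc (2 * k)) (cc_odd k).2.2
    set h : (ZMod 2)[X] := X ^ (2 * k) + a with hh
    have hdeg : h.natDegree = 2 * k := by
      apply natDegree_eq_of_degree_eq_some
      rw [hh, degree_add_eq_left_of_degree_lt, degree_X_pow]
      rwa [degree_X_pow]
    have hne : h ≠ 0 := by
      intro h'
      have : h.coeff (2 * k) = 1 := by
        rw [hh, coeff_add, coeff_X_pow_self, coeff_eq_zero_of_degree_lt ha, add_zero]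
      simp [h'] at this
    have hCC : Clin h = 0 := by
      rw [hh, map_add, Clin_X, hCa]; exact CharTwo.add_self_eq_zero _
    have hD : ((X ^ 2 + X) * h.comp ((X ^ 2 + X) ^ 2) : (ZMod 2)[X]).natDegree = 8 * k + 2 := by
      rw [natDegree_mul hw, natDegree_comp, natDegree_pow, deg_w, hdeg]
      · omega
      · intro h'
        rw [comp_eq_zero_iff] at h'
        rcases h' with h' | ⟨-, h'⟩
        · exact hne h'
        · have := congrArg natDegree h'
          rw [natDegree_pow, deg_w, natDegree_C] at this
          omega
    refine ⟨(X ^ 2 + X) * h.comp ((X ^ 2 + X) ^ 2), ⟨?_, ?_⟩, ?_, hD⟩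
    · apply Submodule.subset_span
      refine ⟨h.comp (X ^ 2 + X), ?_, ?_⟩
      · rw [natDegree_comp, deg_w, hdeg]; omega
      · rw [comp_assoc]
        congr 2
        simp only [add_comp, pow_comp, X_comp]
        grind
    · change U _ + _ = 0
      rw [U_Clin U (U_cc U hsemi h0 h1 h2 h3), hCC, zero_comp, mul_zero, add_zero]
      exact CharTwo.add_self_eq_zero _
    · intro h'
      rw [h'] at hD
      simp at hD
end

section
/- Let N2 be the Z/2[G^2]-submodule of Z/2[r] with basis {G, F, F^2·G}, N1 the submodule with basis {G}, K1 the submodule with basis {G, F}, and pr1 : N2/N1 → K1/N1 the projection coming from the direct sum decomposition N2/N1 = K1/N1 ⊕ K5/N1 (K5 having basis {G, F^2·G}). Let K = ker(U + I : M(odd) → M(odd)). Then the composite map K → N2 → N2/N1 → K1/N1 is a Z/2-linear bijection; explicitly, if f = (r^2+r)·g(r^2) ∈ K is nonzero with deg g = 4m, then pr1(f) = (G^{2m} + (a sum of G^{2k} with k < m))·F. -/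
open Polynomial

noncomputable def Fp : Polynomial (ZMod 2) := X * (X + 1) ^ 3

noncomputable def Gp : Polynomial (ZMod 2) := X ^ 3 * (X + 1)

/-- `M(odd)`: the elements `(r² + r)·g(r²)`. -/
noncomputable def Modd : Submodule (ZMod 2) (Polynomial (ZMod 2)) :=
  Submodule.span (ZMod 2)
    {p | ∃ g : Polynomial (ZMod 2), p = (X ^ 2 + X) * g.comp (X ^ 2)}

/-- `N1`: the `Z/2[G²]`-submodule with basis `{G}`. -/
noncomputable def N1sub : Submodule (ZMod 2) (Polynomial (ZMod 2)) :=
  Submodule.span (ZMod 2) (Set.range fun n : ℕ => Gp * (Gp ^ 2) ^ n)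

/-- `K1`: the `Z/2[G²]`-submodule with basis `{G, F}`. -/
noncomputable def K1sub : Submodule (ZMod 2) (Polynomial (ZMod 2)) :=
  Submodule.span (ZMod 2)
    (Set.range (fun n : ℕ => Gp * (Gp ^ 2) ^ n) ∪ Set.range (fun n : ℕ => Fp * (Gp ^ 2) ^ n))

/-- the `Z/2[G²]`-submodule generated by `F²·G` (so that `K5 = N1 ⊔ K5part`). -/
noncomputable def K5part : Submodule (ZMod 2) (Polynomial (ZMod 2)) :=
  Submodule.span (ZMod 2) (Set.range fun n : ℕ => Fp ^ 2 * Gp * (Gp ^ 2) ^ n)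


abbrev PP := Polynomial (ZMod 2)

theorem pp_two : (2 : PP) = 0 := CharTwo.two_eq_zero

noncomputable def sA : PP := X ^ 3 * (X + 1)
noncomputable def sB : PP := X * (X + 1) ^ 3

theorem sA_monic : sA.Monic := by unfold sA; monicity!
theorem sA_natDegree : sA.natDegree = 4 := by unfold sA; compute_degree!

noncomputable def Ef (a b c d : PP) : PP :=
  aeval sA a * X + aeval sA b + aeval sA c * (X ^ 3 + X ^ 2) + aeval sA d * X ^ 2

theorem Ef_add (a b c d a' b' c' d' : PP) :
    Ef (a + a') (b + b') (c + c') (d + d') = Ef a b c d + Ef a' b' c' d' := by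
  simp only [Ef, map_add]; ring

theorem Ef_sub (a b c d a' b' c' d' : PP) :
    Ef (a - a') (b - b') (c - c') (d - d') = Ef a b c d - Ef a' b' c' d' := by
  simp only [Ef, map_sub]; ring

theorem Ef_smul (k : ZMod 2) (a b c d : PP) :
    Ef (k • a) (k • b) (k • c) (k • d) = k • Ef a b c d := by
  simp only [Ef, map_smul, smul_add, smul_mul_assoc]

theorem Ef_step (a b c d : PP) (a0 b0 c0 d0 : ZMod 2) :
    Ef (a * X + C a0) (b * X + C b0) (c * X + C c0) (d * X + C d0)
      = sA * Ef a b c d + (C c0 * X ^ 3 + C (c0 + d0) * X ^ 2 + C a0 * X + C b0) := by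
  simp only [Ef, map_add, map_mul, aeval_X, aeval_C, algebraMap_eq]; ring

theorem cubic_zero {x y z w : ZMod 2} (h : (C x * X ^ 3 + C y * X ^ 2 + C z * X + C w : PP) = 0) :
    x = 0 ∧ y = 0 ∧ z = 0 ∧ w = 0 := by
  refine ⟨?_, ?_, ?_, ?_⟩
  · simpa [coeff_X, coeff_C, coeff_X_pow] using congrArg (fun p => coeff p 3) h
  · simpa [coeff_X, coeff_C, coeff_X_pow] using congrArg (fun p => coeff p 2) h
  · simpa [coeff_X, coeff_C, coeff_X_pow] using congrArg (fun p => coeff p 1) h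
  · simpa [coeff_X, coeff_C, coeff_X_pow] using congrArg (fun p => coeff p 0) h

theorem divX_lt {p : PP} {n : ℕ} (h : p.degree < (n + 1 : ℕ)) : p.divX.degree < n := by
  rw [degree_lt_iff_coeff_zero] at h ⊢
  intro m hm
  rw [coeff_divX]; exact h _ (by omega)

theorem Ef_inj_aux (n : ℕ) : ∀ a b c d : PP, a.degree < n → b.degree < n → c.degree < n →
    d.degree < n → Ef a b c d = 0 → a = 0 ∧ b = 0 ∧ c = 0 ∧ d = 0 := by
  induction n with
  | zero =>
    intro a b c d ha hb hc hd _
    simp [degree_eq_bot] at *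
    simp_all
  | succ n ih =>
    intro a b c d ha hb hc hd h
    have h' := h
    rw [← divX_mul_X_add a, ← divX_mul_X_add b, ← divX_mul_X_add c, ← divX_mul_X_add d,
      Ef_step] at h
    set r : PP := C (c.coeff 0) * X ^ 3 + C (c.coeff 0 + d.coeff 0) * X ^ 2 + C (a.coeff 0) * X
      + C (b.coeff 0) with hr
    have hrd : r.degree < sA.degree := by
      rw [degree_eq_natDegree sA_monic.ne_zero, sA_natDegree]
      refine lt_of_le_of_lt degree_cubic_le ?_
      norm_num
    have := div_modByMonic_unique (f := (0 : PP)) _ _ sA_monic ⟨by rw [add_comm]; exact h, hrd⟩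
    simp only [zero_divByMonic, zero_modByMonic] at this
    obtain ⟨h1, h2⟩ := this
    obtain ⟨x, y, z, w⟩ := cubic_zero (hr.symm.trans h2.symm)
    obtain ⟨k1, k2, k3, k4⟩ := ih _ _ _ _ (divX_lt ha) (divX_lt hb) (divX_lt hc) (divX_lt hd) h1.symm
    rw [x, zero_add] at y
    rw [← divX_mul_X_add a, ← divX_mul_X_add b, ← divX_mul_X_add c, ← divX_mul_X_add d,
      k1, k2, k3, k4, x, y, z, w]
    simp

theorem Ef_inj {a b c d : PP} (h : Ef a b c d = 0) : a = 0 ∧ b = 0 ∧ c = 0 ∧ d = 0 := by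
  have key : ∀ p : PP, p.natDegree ≤ a.natDegree + b.natDegree + c.natDegree + d.natDegree →
      p.degree < ((a.natDegree + b.natDegree + c.natDegree + d.natDegree + 1 : ℕ) : WithBot ℕ) := by
    intro p hp
    refine lt_of_le_of_lt degree_le_natDegree ?_
    exact_mod_cast Nat.lt_succ_of_le hp
  exact Ef_inj_aux _ a b c d (key _ (by omega)) (key _ (by omega)) (key _ (by omega))
    (key _ (by omega)) h

theorem Ef_uniq {a b c d a' b' c' d' : PP} (h : Ef a b c d = Ef a' b' c' d') :
    a = a' ∧ b = b' ∧ c = c' ∧ d = d' := by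
  have := Ef_inj (a := a - a') (b := b - b') (c := c - c') (d := d - d')
    (by rw [Ef_sub, h, sub_self])
  simpa [sub_eq_zero] using this

theorem mulX_lt {p : PP} {n : ℕ} (k : ZMod 2) (h : p.degree < n) :
    (p * X + C k).degree < ((n + 1 : ℕ) : WithBot ℕ) := by
  rw [degree_lt_iff_coeff_zero] at h ⊢
  intro m hm
  obtain ⟨m, rfl⟩ : ∃ j, m = j + 1 := ⟨m - 1, by omega⟩
  simp [h m (by omega)]

theorem Ef_exists (k : ℕ) (hk : k = 0 ∨ k = 1) (n : ℕ) : ∀ g : PP, g.degree < (4 * n + 2 * k : ℕ) →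
    ∃ a b c d : PP, g = Ef a b c d ∧ a.degree < (n + k : ℕ) ∧ b.degree < (n + k : ℕ) ∧
      c.degree < n ∧ d.degree < n := by
  induction n with
  | zero =>
    intro g hg
    rcases hk with rfl | rfl
    · refine ⟨0, 0, 0, 0, ?_, by simp, by simp, by simp, by simp⟩
      have : g = 0 := by
        rw [degree_lt_iff_coeff_zero] at hg
        ext m; simpa using hg m (by omega)
      simp [this, Ef]
    · refine ⟨C (g.coeff 1), C (g.coeff 0), 0, 0, ?_, ?_, ?_, by simp, by simp⟩
      · have : g.degree ≤ 1 := by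
          rw [degree_lt_iff_coeff_zero] at hg
          rw [show (1 : WithBot ℕ) = ((1 : ℕ) : WithBot ℕ) from rfl, degree_le_iff_coeff_zero]
          intro m hm
          exact hg m (by have : 1 < m := by exact_mod_cast hm
                         omega)
        simpa [Ef] using eq_X_add_C_of_degree_le_one this
      · exact lt_of_le_of_lt degree_C_le (by norm_num)
      · exact lt_of_le_of_lt degree_C_le (by norm_num)
  | succ n ih =>
    intro g hg
    have hq : (g /ₘ sA).degree < (4 * n + 2 * k : ℕ) := by
      by_cases h0 : g /ₘ sA = 0
      · rw [h0, degree_zero]; exact WithBot.bot_lt_coe _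
      · rw [← natDegree_lt_iff_degree_lt h0, natDegree_divByMonic _ sA_monic, sA_natDegree]
        have hg0 : g ≠ 0 := by rintro rfl; simp at h0
        have h1 := (natDegree_lt_iff_degree_lt hg0).2 hg
        have : 4 ≤ g.natDegree := by
          by_contra hlt
          apply h0
          rw [divByMonic_eq_zero_iff sA_monic]
          apply degree_lt_degree
          rw [sA_natDegree]; omega
        omega
    obtain ⟨a, b, c, d, he, ha, hb, hc, hd⟩ := ih _ hq
    have hr : (g %ₘ sA).natDegree ≤ 3 := by
      have := natDegree_modByMonic_lt g sA_monic (by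
        intro h; have := sA_natDegree; rw [h] at this; simp at this)
      rw [sA_natDegree] at this; omega
    set r := g %ₘ sA with hrr
    have hr' : r = C (r.coeff 3) * X ^ 3 + C (r.coeff 2) * X ^ 2 + C (r.coeff 1) * X
        + C (r.coeff 0) := by
      conv_lhs => rw [as_sum_range_C_mul_X_pow' r (n := 4) (by omega)]
      simp [Finset.sum_range_succ]; ring
    refine ⟨a * X + C (r.coeff 1), b * X + C (r.coeff 0), c * X + C (r.coeff 3),
      d * X + C (r.coeff 2 - r.coeff 3), ?_, ?_, ?_, mulX_lt _ hc, mulX_lt _ hd⟩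
    · rw [Ef_step, ← he, add_sub_cancel, ← hr', add_comm]
      exact (modByMonic_add_div g sA).symm
    · rw [show n + 1 + k = n + k + 1 by ring]; exact mulX_lt _ ha
    · rw [show n + 1 + k = n + k + 1 by ring]; exact mulX_lt _ hb

theorem zmod2_ne {x : ZMod 2} (h : x ≠ 0) : x = 1 := by revert x; decide

theorem pp_monic {g : PP} (h : g ≠ 0) : g.Monic := zmod2_ne (leadingCoeff_ne_zero.2 h)

theorem sub_deg {g h : PP} (hg : g.Monic) (hh : h.Monic) {n : ℕ} (h1 : g.natDegree = n)
    (h2 : h.natDegree = n) : (g - h).degree < n := by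
  have := degree_sub_lt (p := g) (q := h)
    (by rw [degree_eq_natDegree hg.ne_zero, degree_eq_natDegree hh.ne_zero, h1, h2]) hg.ne_zero
    (by rw [hg, hh])
  rwa [degree_eq_natDegree hg.ne_zero, h1] at this

theorem Ef_deg0 {g : PP} (hg : g ≠ 0) {m : ℕ} (h : g.natDegree = 4 * m) :
    ∃ a b c d : PP, g = Ef a (X ^ m + b) c d ∧ b.degree < m ∧ d.degree < m := by
  have hm : (sA ^ m).natDegree = 4 * m := by rw [sA_monic.natDegree_pow, sA_natDegree, mul_comm]
  obtain ⟨a, b, c, d, he, ha, hb, hc, hd⟩ := Ef_exists 0 (Or.inl rfl) m _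
    (sub_deg (pp_monic hg) (sA_monic.pow m) h hm)
  refine ⟨a, b, c, d, ?_, hb, hd⟩
  rw [sub_eq_iff_eq_add] at he
  rw [he]; simp [Ef]; ring

theorem Ef_deg2 {g : PP} (hg : g ≠ 0) {m : ℕ} (h : g.natDegree = 4 * m + 2) :
    ∃ a b c d : PP, g = Ef a b c (X ^ m + d) ∧ b.degree < (m + 1 : ℕ) ∧ d.degree < m := by
  have hm : (sA ^ m * X ^ 2).natDegree = 4 * m + 2 := by
    rw [natDegree_mul_X_pow _ (sA_monic.pow m).ne_zero, sA_monic.natDegree_pow, sA_natDegree, mul_comm]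
  obtain ⟨a, b, c, d, he, ha, hb, hc, hd⟩ := Ef_exists 1 (Or.inr rfl) m _
    (sub_deg (pp_monic hg) ((sA_monic.pow m).mul (monic_X_pow 2)) h hm)
  refine ⟨a, b, c, d, ?_, hb, hd⟩
  rw [sub_eq_iff_eq_add] at he
  rw [he]; simp [Ef]; ring

theorem Xm_ne {m : ℕ} {b : PP} (h : b.degree < m) : (X ^ m + b : PP) ≠ 0 :=
  (monic_X_pow_add h).ne_zero

/-- the swap `s ↦ s + 1` -/
noncomputable def w : PP →ₐ[ZMod 2] PP := aeval (X + 1)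

theorem w_X : w X = X + 1 := by simp [w]
theorem w_A : w sA = sB := by
  simp only [sA, sB, map_mul, map_pow, map_add, w_X, map_one]
  linear_combination (X + 1) ^ 3 * pp_two
theorem w_B : w sB = sA := by
  simp only [sA, sB, map_mul, map_pow, map_add, w_X, map_one]
  linear_combination (X + 1) * (3 * X ^ 2 + 6 * X + 4) * pp_two
theorem w_w (g : PP) : w (w g) = g := by
  have : w.comp w = AlgHom.id _ _ := by
    apply algHom_ext; simp [w_X]; linear_combination pp_two
  exact DFunLike.congr_fun this g
theorem w_aeval (h p : PP) : w (aeval h p) = aeval (w h) p := (aeval_algHom_apply w h p).symm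

theorem w_even {g : PP} (hg : g ≠ 0) (h : w g = g) : Even g.natDegree := by
  by_contra ho
  rw [Nat.not_even_iff_odd] at ho
  obtain ⟨k, hk⟩ := ho
  have h1 : w g = ∑ i ∈ Finset.range (2 * k + 2), C (g.coeff i) * (X + 1) ^ i := by
    conv_lhs => rw [as_sum_range_C_mul_X_pow' g (n := 2 * k + 2) (by omega)]
    simp [w]
  have h2 := congrArg (fun p => coeff p (2 * k)) h1
  simp only [h, finsetSum_coeff, coeff_C_mul, coeff_X_add_one_pow] at h2
  rw [Finset.sum_range_succ, Finset.sum_range_succ, Finset.sum_eq_zero] at h2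
  · have : g.coeff (2 * k + 1) = 0 := by
      have e : ((2 * k + 1 : ℕ) : ZMod 2) = 1 := by
        push_cast; rw [show (2 : ZMod 2) = 0 from rfl]; simp
      simp only [Nat.choose_self, Nat.choose_succ_self_right, e] at h2
      simpa using h2
    rw [← hk] at this
    exact hg (leadingCoeff_eq_zero.1 this)
  · intro i hi
    rw [Nat.choose_eq_zero_of_lt (Finset.mem_range.1 hi)]; simp

theorem winv_inj {a c : PP} (h : w (Ef a 0 c 0) = Ef a 0 c 0) : Ef a 0 c 0 = 0 := by
  by_contra h0
  obtain ⟨k, hk⟩ := w_even h0 h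
  rcases Nat.even_or_odd' k with ⟨m, rfl | rfl⟩
  · obtain ⟨a', b', c', d', he, hb, hd⟩ := Ef_deg0 h0 (m := m) (by omega)
    exact Xm_ne hb (Ef_uniq he).2.1.symm
  · obtain ⟨a', b', c', d', he, hb, hd⟩ := Ef_deg2 h0 (m := m) (by omega)
    exact Xm_ne hd (Ef_uniq he).2.2.2.symm

theorem tt_monic : (X ^ 2 + X : PP).Monic := by monicity!
theorem tt_deg : (X ^ 2 + X : PP).natDegree = 2 := by compute_degree!
theorem w_tt : w (X ^ 2 + X : PP) = X ^ 2 + X := by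
  simp only [map_pow, map_add, w_X]; linear_combination (X + 1) * pp_two

theorem peel {p q : PP} {n : ℕ} (hp : p.degree < (n + 1 : ℕ)) (hq : q.degree < n) :
    (p - p.coeff n • (X ^ n + q)).degree < (n : WithBot ℕ) := by
  rw [degree_lt_iff_coeff_zero] at *
  intro m hm
  rcases hm.eq_or_lt with rfl | hm'
  · simp [hq n le_rfl]
  · simp [hp m (by omega), hq m hm, coeff_X_pow, hm'.ne']

theorem deg_sub_smul {p q : PP} {n : ℕ} (k : ZMod 2) (hp : p.degree < n) (hq : q.degree < n) :
    (p - k • q).degree < n := by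
  rw [degree_lt_iff_coeff_zero] at *
  intro m hm
  simp [hp m hm, hq m hm]

theorem winv_surj_aux (n : ℕ) : ∀ b d : PP, b.degree < n → d.degree < n →
    ∃ a c : PP, w (Ef a b c d) = Ef a b c d := by
  induction n with
  | zero =>
    intro b d hb hd
    have hb0 : b = 0 := by
      rw [degree_lt_iff_coeff_zero] at hb
      ext m; simpa using hb m (by omega)
    have hd0 : d = 0 := by
      rw [degree_lt_iff_coeff_zero] at hd
      ext m; simpa using hd m (by omega)
    exact ⟨0, 0, by simp [hb0, hd0, Ef]⟩
  | succ n ih =>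
    intro b d hb hd
    have t1 : ((X ^ 2 + X : PP) ^ (2 * n)).natDegree = 4 * n := by
      rw [tt_monic.natDegree_pow, tt_deg]; ring
    have t2 : ((X ^ 2 + X : PP) ^ (2 * n + 1)).natDegree = 4 * n + 2 := by
      rw [tt_monic.natDegree_pow, tt_deg]; ring
    obtain ⟨a2, b2, c2, d2, e2, hb2, hd2⟩ := Ef_deg0 (tt_monic.pow _).ne_zero t1
    obtain ⟨a1, b1, c1, d1, e1, hb1, hd1⟩ := Ef_deg2 (tt_monic.pow _).ne_zero t2
    set δ := d.coeff n
    set b' := b - δ • b1 with hb'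
    set β := b'.coeff n
    obtain ⟨a, c, h⟩ := ih (b' - β • (X ^ n + b2)) (d - δ • (X ^ n + d1) - β • d2)
      (peel (deg_sub_smul _ hb hb1) hb2) (deg_sub_smul _ (peel hd hd1) hd2)
    refine ⟨a + δ • a1 + β • a2, c + δ • c1 + β • c2, ?_⟩
    have hE : Ef (a + δ • a1 + β • a2) b (c + δ • c1 + β • c2) d
        = Ef a (b' - β • (X ^ n + b2)) c (d - δ • (X ^ n + d1) - β • d2)
          + δ • (X ^ 2 + X : PP) ^ (2 * n + 1) + β • (X ^ 2 + X : PP) ^ (2 * n) := by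
      rw [e1, e2, ← Ef_smul, ← Ef_smul, ← Ef_add, ← Ef_add]
      congr 1
      · rw [hb']; abel
      · abel
    rw [hE, map_add, map_add, h, map_smul, map_smul, map_pow, map_pow, w_tt]

theorem winv_surj (b : PP) : ∃ a c : PP, w (Ef a b c 0) = Ef a b c 0 :=
  winv_surj_aux (b.natDegree + 1) b 0
    (lt_of_le_of_lt degree_le_natDegree (by exact_mod_cast Nat.lt_succ_self _)) (by
      rw [degree_zero]; exact WithBot.bot_lt_coe _)

theorem descent (n : ℕ) : ∀ (k : ℕ) (d : PP), d.degree < n →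
    (X + 1) ^ (k + 1) * aeval sB d = X ^ (k + 1) * aeval sA d → d = 0 := by
  induction n with
  | zero =>
    intro k d hd _
    rw [degree_lt_iff_coeff_zero] at hd
    ext m; simpa using hd m (by omega)
  | succ n ih =>
    intro k d hd h
    have h0 : d.coeff 0 = 0 := by
      have := congrArg (eval 0) h
      rw [← divX_mul_X_add d] at this
      simpa [sB] using this
    have hd' : d = d.divX * X := by
      conv_lhs => rw [← divX_mul_X_add d, h0]
      simp
    rw [hd'] at h
    simp only [map_mul, aeval_X] at h
    have hne : (X * (X + 1) : PP) ≠ 0 := mul_ne_zero X_ne_zero (X_add_C_ne_zero (1 : ZMod 2))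
    have := ih (k + 2) d.divX (divX_lt hd) (mul_left_cancel₀ hne (by
      simp only [sA, sB] at h ⊢
      linear_combination h))
    rw [hd', this, zero_mul]

theorem d_zero {d : PP} (h : (X + 1) * aeval sB d = X * aeval sA d) : d = 0 :=
  descent (d.natDegree + 1) 0 d
    (lt_of_le_of_lt degree_le_natDegree (by exact_mod_cast Nat.lt_succ_self _)) (by simpa using h)

noncomputable def iot : PP →ₗ[ZMod 2] PP :=
  LinearMap.mulLeft (ZMod 2) (X ^ 2 + X) ∘ₗ (aeval (X ^ 2 : PP)).toLinearMap

theorem iot_apply (g : PP) : iot g = (X ^ 2 + X) * aeval (X ^ 2 : PP) g := rfl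

theorem comp_eq (g h : PP) : g.comp h = aeval h g := rfl

theorem iot_inj : Function.Injective iot := by
  rw [injective_iff_map_eq_zero]
  intro g hg
  rw [iot_apply, mul_eq_zero] at hg
  rcases hg with h | h
  · exact absurd h tt_monic.ne_zero
  · rw [← comp_eq, ← expand_eq_comp_X_pow] at h
    exact (expand_eq_zero (by norm_num)).1 h

theorem Modd_mem {f : PP} : f ∈ Modd ↔ ∃ g, f = iot g := by
  constructor
  · intro h
    have : Modd ≤ LinearMap.range iot := by
      unfold Modd
      rw [Submodule.span_le]
      rintro _ ⟨g, rfl⟩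
      exact ⟨g, rfl⟩
    obtain ⟨g, hg⟩ := this h
    exact ⟨g, hg.symm⟩
  · rintro ⟨g, rfl⟩
    exact Submodule.subset_span ⟨g, rfl⟩

theorem G2 : aeval (X ^ 2 : PP) sA = Gp ^ 2 := by
  simp only [sA, Gp, map_mul, map_pow, map_add, aeval_X, map_one]
  linear_combination (-X ^ 7) * pp_two

theorem F2 : aeval (X ^ 2 : PP) sB = Fp ^ 2 := by
  simp only [sB, Fp, map_mul, map_pow, map_add, aeval_X, map_one]
  linear_combination (-(X ^ 2 * (3 * X ^ 5 + 6 * X ^ 4 + 10 * X ^ 3 + 6 * X ^ 2 + 3 * X))) * pp_two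

theorem aeval_G (p : PP) : aeval (X ^ 2 : PP) (aeval sA p) = aeval (Gp ^ 2) p := by
  rw [← aeval_algHom_apply, G2]

theorem aeval_F (p : PP) : aeval (X ^ 2 : PP) (aeval sB p) = aeval (Fp ^ 2) p := by
  rw [← aeval_algHom_apply, F2]

/-- `ι E` in terms of `G`, `F`, `F² G`. -/
theorem iot_Ef (a b c : PP) : iot (Ef a b c 0) =
    Gp * aeval (Gp ^ 2) (a + b + X * c) + Fp * aeval (Gp ^ 2) b
      + Fp ^ 2 * Gp * aeval (Gp ^ 2) c := by
  simp only [iot_apply, Ef, map_add, map_mul, map_zero, aeval_G, map_pow, aeval_X]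
  generalize aeval (Gp ^ 2) a = a
  generalize aeval (Gp ^ 2) b = b
  generalize aeval (Gp ^ 2) c = c
  simp only [Gp, Fp]
  have h2 := pp_two
  grind

theorem U_pow (U : PP →ₗ[ZMod 2] PP) (hsemi : ∀ f, U (Gp * f) = Fp * U f) (h p : PP) :
    U (aeval (Gp ^ 2) h * p) = aeval (Fp ^ 2) h * U p := by
  induction h using Polynomial.induction_on' with
  | add a b ha hb => simp only [map_add, add_mul, ha, hb]
  | monomial n k =>
    simp only [aeval_monomial, algebraMap_eq, ← smul_eq_C_mul, smul_mul_assoc, map_smul]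
    congr 1
    induction n with
    | zero => simp
    | succ n ih =>
      rw [pow_succ', mul_assoc, pow_two, mul_assoc, hsemi, hsemi, ← pow_two, ih]; ring

theorem U_iot (U : PP →ₗ[ZMod 2] PP) (hsemi : ∀ f, U (Gp * f) = Fp * U f)
    (h0 : U 1 = 1) (h1 : U X = X) (h2 : U (X ^ 2) = X ^ 2)
    (h3 : U (X ^ 3) = X ^ 3 + X ^ 2 + X) (a b c d : PP) :
    U (iot (Ef a b c d)) = iot (w (Ef a b c d) + (X + 1) * aeval sB d) := by
  have e : iot (Ef a b c d) = aeval (Gp ^ 2) a * (Gp * 1) + aeval (Gp ^ 2) b * (X ^ 2 + X)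
      + aeval (Gp ^ 2) c * (Gp * (Gp * 1 + X ^ 3 + X ^ 2)) + aeval (Gp ^ 2) d * (Gp * X ^ 2) := by
    simp only [iot_apply, Ef, map_add, map_mul, aeval_G, map_pow, aeval_X]
    generalize aeval (Gp ^ 2) a = a
    generalize aeval (Gp ^ 2) b = b
    generalize aeval (Gp ^ 2) c = c
    simp only [Gp]
    linear_combination (-c * X ^ 6 * (X + 1)) * pp_two
  rw [e]
  simp only [iot_apply, Ef, map_add, map_mul, map_pow, w_aeval, w_A, aeval_F, aeval_X, w_X,
    U_pow U hsemi, hsemi, h0, h1, h2, h3, map_one]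
  generalize aeval (Fp ^ 2) a = a
  generalize aeval (Fp ^ 2) b = b
  generalize aeval (Fp ^ 2) c = c
  generalize aeval (Fp ^ 2) d = d
  simp only [Fp]
  have h2 := pp_two
  grind

theorem ker_char (U : PP →ₗ[ZMod 2] PP) (hsemi : ∀ f, U (Gp * f) = Fp * U f)
    (h0 : U 1 = 1) (h1 : U X = X) (h2 : U (X ^ 2) = X ^ 2)
    (h3 : U (X ^ 3) = X ^ 3 + X ^ 2 + X) (f : PP) :
    f ∈ Modd ⊓ LinearMap.ker (U + LinearMap.id) ↔
      ∃ a b c : PP, f = iot (Ef a b c 0) ∧ w (Ef a b c 0) = Ef a b c 0 := by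
  rw [Submodule.mem_inf, Modd_mem, LinearMap.mem_ker, LinearMap.add_apply, LinearMap.id_apply]
  constructor
  · rintro ⟨⟨g, rfl⟩, hf⟩
    obtain ⟨a, b, c, d, rfl, -⟩ := Ef_exists 0 (Or.inl rfl) (g.natDegree + 1) g
      (lt_of_le_of_lt degree_le_natDegree (by exact_mod_cast (by omega)))
    rw [U_iot U hsemi h0 h1 h2 h3, ← map_add] at hf
    have hf := (injective_iff_map_eq_zero iot).1 iot_inj _ hf
    have hw := congrArg w hf
    simp only [map_add, map_mul, w_w, w_aeval, w_B, w_X, map_one, map_zero] at hw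
    have hd : d = 0 := d_zero (by
      linear_combination hf - hw + (aeval sA d) * pp_two)
    subst hd
    refine ⟨a, b, c, rfl, ?_⟩
    simp only [map_zero, mul_zero, add_zero] at hf
    linear_combination hf - (Ef a b c 0) * pp_two
  · rintro ⟨a, b, c, rfl, hw⟩
    refine ⟨⟨_, rfl⟩, ?_⟩
    rw [U_iot U hsemi h0 h1 h2 h3, hw, map_zero, mul_zero, add_zero]
    linear_combination (iot (Ef a b c 0)) * pp_two

theorem span_mem (H x : PP) : x ∈ Submodule.span (ZMod 2) (Set.range fun n : ℕ => H * (Gp ^ 2) ^ n)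
    ↔ ∃ p : PP, x = H * aeval (Gp ^ 2) p := by
  constructor
  · intro h
    induction h using Submodule.span_induction with
    | mem x h => obtain ⟨n, rfl⟩ := h; exact ⟨X ^ n, by simp⟩
    | zero => exact ⟨0, by simp⟩
    | add x y _ _ hx hy =>
      obtain ⟨p, rfl⟩ := hx
      obtain ⟨q, rfl⟩ := hy
      exact ⟨p + q, by rw [map_add, mul_add]⟩
    | smul k x _ hx =>
      obtain ⟨p, rfl⟩ := hx
      exact ⟨k • p, by rw [map_smul, mul_smul_comm]⟩
  · rintro ⟨p, rfl⟩
    rw [aeval_eq_sum_range, Finset.mul_sum]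
    refine Submodule.sum_mem _ fun i _ => ?_
    rw [mul_smul_comm]
    exact Submodule.smul_mem _ _ (Submodule.subset_span ⟨i, rfl⟩)

theorem N1_mem (x : PP) : x ∈ N1sub ↔ ∃ p : PP, x = Gp * aeval (Gp ^ 2) p := span_mem _ _
theorem K5_mem (x : PP) : x ∈ K5part ↔ ∃ p : PP, x = Fp ^ 2 * Gp * aeval (Gp ^ 2) p := span_mem _ _
theorem K1_mem (x : PP) : x ∈ K1sub ↔
    ∃ p q : PP, x = Gp * aeval (Gp ^ 2) p + Fp * aeval (Gp ^ 2) q := by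
  unfold K1sub
  rw [Submodule.span_union, Submodule.mem_sup]
  simp only [span_mem]
  constructor
  · rintro ⟨_, ⟨p, rfl⟩, _, ⟨q, rfl⟩, rfl⟩; exact ⟨p, q, rfl⟩
  · rintro ⟨p, q, rfl⟩; exact ⟨_, ⟨p, rfl⟩, _, ⟨q, rfl⟩, rfl⟩

/-- uniqueness of the coefficient of `F` -/
theorem F_coef {a b c p q s : PP} (h : iot (Ef a b c 0) =
    Gp * aeval (Gp ^ 2) p + Fp * aeval (Gp ^ 2) q + Fp ^ 2 * Gp * aeval (Gp ^ 2) s) : b = q := by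
  have : iot (Ef a b c 0) = iot (Ef (p - q - X * s) q s 0) := by
    rw [h, iot_Ef]; congr 4; ring
  exact (Ef_uniq (iot_inj this)).2.1

noncomputable def Elin : (PP × PP × PP × PP) →ₗ[ZMod 2] PP where
  toFun x := Ef x.1 x.2.1 x.2.2.1 x.2.2.2
  map_add' x y := Ef_add _ _ _ _ _ _ _ _
  map_smul' k x := Ef_smul _ _ _ _ _

theorem exists_coef : ∃ β : PP →ₗ[ZMod 2] PP, ∀ a b c d, β (iot (Ef a b c d)) = b := by
  have hi : Function.Injective (iot ∘ₗ Elin) := by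
    refine iot_inj.comp ?_
    intro x y h
    obtain ⟨h1, h2, h3, h4⟩ := Ef_uniq h
    exact Prod.ext h1 (Prod.ext h2 (Prod.ext h3 h4))
  obtain ⟨l, hl⟩ := LinearMap.exists_leftInverse_of_injective _ (LinearMap.ker_eq_bot.2 hi)
  refine ⟨LinearMap.fst _ _ _ ∘ₗ LinearMap.snd _ _ _ ∘ₗ l, fun a b c d => ?_⟩
  have := LinearMap.congr_fun hl (a, b, c, d)
  have h' : l (iot (Ef a b c d)) = (a, b, c, d) := this
  simp [h']

noncomputable def kap : PP →ₗ[ZMod 2] ↥K1sub :=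
  LinearMap.codRestrict K1sub (LinearMap.mulLeft (ZMod 2) Fp ∘ₗ (aeval (Gp ^ 2)).toLinearMap)
    (fun q => (K1_mem _).2 ⟨0, q, by simp⟩)

theorem kap_coe (q : PP) : ((kap q : ↥K1sub) : PP) = Fp * aeval (Gp ^ 2) q := rfl

theorem stmt19 (U : Polynomial (ZMod 2) →ₗ[ZMod 2] Polynomial (ZMod 2))
    (hsemi : ∀ f, U (X ^ 3 * (X + 1) * f) = X * (X + 1) ^ 3 * U f)
    (h0 : U 1 = 1) (h1 : U X = X) (h2 : U (X ^ 2) = X ^ 2)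
    (h3 : U (X ^ 3) = X ^ 3 + X ^ 2 + X) :
    ∃ φ : ↥(Modd ⊓ LinearMap.ker (U + LinearMap.id)) →ₗ[ZMod 2]
        (↥K1sub ⧸ N1sub.comap K1sub.subtype),
      Function.Bijective φ ∧
      (∀ (f : ↥(Modd ⊓ LinearMap.ker (U + LinearMap.id))) (a : ↥K1sub),
        (f : Polynomial (ZMod 2)) - (a : Polynomial (ZMod 2)) ∈ N1sub ⊔ K5part →
        φ f = Submodule.Quotient.mk a) ∧
      (∀ (f : ↥(Modd ⊓ LinearMap.ker (U + LinearMap.id))) (g : Polynomial (ZMod 2)) (m : ℕ),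
        (f : Polynomial (ZMod 2)) ≠ 0 →
        (f : Polynomial (ZMod 2)) = (X ^ 2 + X) * g.comp (X ^ 2) →
        g.natDegree = 4 * m →
        ∃ (a : ↥K1sub) (c : ℕ → ZMod 2),
          φ f = Submodule.Quotient.mk a ∧
          (a : Polynomial (ZMod 2)) =
            (Gp ^ (2 * m) + ∑ k ∈ Finset.range m, c k • Gp ^ (2 * k)) * Fp) := by
  have hker := ker_char U hsemi h0 h1 h2 h3
  obtain ⟨β, hβ⟩ := exists_coef
  let φ : ↥(Modd ⊓ LinearMap.ker (U + LinearMap.id)) →ₗ[ZMod 2]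
      (↥K1sub ⧸ N1sub.comap K1sub.subtype) :=
    (N1sub.comap K1sub.subtype).mkQ ∘ₗ kap ∘ₗ β ∘ₗ Submodule.subtype _
  have hφ : ∀ f, φ f = Submodule.Quotient.mk (kap (β f)) := fun f => rfl
  refine ⟨φ, ⟨?_, ?_⟩, ?_, ?_⟩
  · rw [injective_iff_map_eq_zero]
    rintro ⟨f, hf⟩ h
    obtain ⟨a, b, c, rfl, hw⟩ := (hker f).1 hf
    rw [hφ, hβ, Submodule.Quotient.mk_eq_zero, Submodule.mem_comap] at h
    obtain ⟨p, hp⟩ := (N1_mem _).1 h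
    have hp : Fp * aeval (Gp ^ 2) b = Gp * aeval (Gp ^ 2) p := hp
    have hb : b = 0 := by
      have : iot (Ef (0 - b) b 0 0) = Gp * aeval (Gp ^ 2) p + Fp * aeval (Gp ^ 2) (0 : PP)
          + Fp ^ 2 * Gp * aeval (Gp ^ 2) (0 : PP) := by
        rw [iot_Ef, hp]; simp
      exact F_coef this
    subst hb
    ext1
    simp [winv_inj hw]
  · intro y
    obtain ⟨x, rfl⟩ := Submodule.Quotient.mk_surjective _ y
    obtain ⟨p, q, hpq⟩ := (K1_mem _).1 x.2
    obtain ⟨a, c, hw⟩ := winv_surj q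
    refine ⟨⟨iot (Ef a q c 0), (hker _).2 ⟨a, q, c, rfl, hw⟩⟩, ?_⟩
    rw [hφ, hβ, Submodule.Quotient.eq, Submodule.mem_comap, N1_mem]
    refine ⟨-p, ?_⟩
    simp only [Submodule.subtype_apply, Submodule.coe_sub, kap_coe, hpq, map_neg]
    ring
  · rintro ⟨f, hf⟩ x hx
    obtain ⟨a, b, c, rfl, hw⟩ := (hker f).1 hf
    obtain ⟨p, q, hpq⟩ := (K1_mem _).1 x.2
    obtain ⟨_, hy, _, hz, hyz⟩ := Submodule.mem_sup.1 hx
    obtain ⟨p', rfl⟩ := (N1_mem _).1 hy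
    obtain ⟨s, rfl⟩ := (K5_mem _).1 hz
    have hb : b = q := F_coef (a := a) (c := c) (p := p + p') (s := s) (by
      rw [hpq] at hyz
      rw [map_add]
      linear_combination -hyz)
    subst hb
    rw [hφ, hβ, Submodule.Quotient.eq, Submodule.mem_comap, N1_mem]
    refine ⟨-p, ?_⟩
    simp only [Submodule.subtype_apply, Submodule.coe_sub, kap_coe, hpq, map_neg]
    ring
  · rintro ⟨f, hf⟩ g m hf0 hfg hm
    obtain ⟨a, b, c, rfl, hw⟩ := (hker f).1 hf
    have hg : Ef a b c 0 = g := iot_inj hfg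
    have hg0 : g ≠ 0 := by
      rintro rfl
      exact hf0 (by simp [hg])
    obtain ⟨a', b', c', d', he, hb', -⟩ := Ef_deg0 hg0 hm
    have hb : b = X ^ m + b' := (Ef_uniq (hg.trans he)).2.1
    refine ⟨kap b, b'.coeff, by rw [hφ, hβ], ?_⟩
    rw [kap_coe, hb, mul_comm, map_add, map_pow, aeval_X, ← pow_mul]
    congr 2
    by_cases hb0 : b' = 0
    · simp [hb0]
    · rw [aeval_eq_sum_range' ((natDegree_lt_iff_degree_lt hb0).2 hb')]
      simp only [← pow_mul]
end
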